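/- arXiv:math/0004137 — 2 statements merged into one kernel-verified Lean document; each statement's English description precedes it below -/
import Mathlib

section
/- (Littlewood–Richardson rule for stable Grothendieck polynomials) For all partitions λ and μ and every m ≥ 1, the identity G_λ(x_1,…,x_m)·G_μ(x_1,…,x_m) = Σ_ν c^ν_{λμ}·G_ν(x_1,…,x_m) holds in ℤ[x_1,…,x_m], where the sum is over all partitions ν (only finitely many terms being nonzero, since c^ν_{λμ} ≠ 0 for only finitely many ν). -/
open MvPolynomial

/-- A set-valued tableau on an arbitrary finite set of boxes `(row, column)`.
Entries are `0`-based: the entry `i : ℕ` stands for the integer `i + 1`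
(equivalently, for the variable `x_{i+1}`).  Rows weakly increase from left to
right and columns strictly increase from top to bottom, expressed via
horizontally and vertically adjacent boxes. -/
structure SVT (cells : Finset (ℕ × ℕ)) where
  entry : ℕ × ℕ → Finset ℕ
  nonempty_of_mem : ∀ c ∈ cells, (entry c).Nonempty
  eq_empty_of_not_mem : ∀ c, c ∉ cells → entry c = ∅
  row_weak : ∀ i j, (i, j) ∈ cells → (i, j + 1) ∈ cells →
    ∀ a ∈ entry (i, j), ∀ b ∈ entry (i, j + 1), a ≤ b
  col_strict : ∀ i j, (i, j) ∈ cells → (i + 1, j) ∈ cells →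
    ∀ a ∈ entry (i, j), ∀ b ∈ entry (i + 1, j), a < b

namespace SVT

variable {cells : Finset (ℕ × ℕ)}

/-- `|T|`: the total number of integers in the boxes of `T`. -/
def size (T : SVT cells) : ℕ := ∑ c ∈ cells, (T.entry c).card

/-- `T` has all its entries among `{1, …, m}` (i.e. `0`-based entries `< m`). -/
def Bounded (T : SVT cells) (m : ℕ) : Prop := ∀ c, ∀ x ∈ T.entry c, x < m

/-- The monomial `x^T`, where the exponent of the variable `i` is the number of
boxes of `T` containing `i`. -/
noncomputable def monomial (T : SVT cells) : MvPolynomial ℕ ℤ :=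
  ∏ c ∈ cells, ∏ i ∈ T.entry c, X i

/-- The column word of `T`: columns are read from left to right, each column
from bottom to top, the integers within a box in increasing order. -/
def word (T : SVT cells) : List ℕ :=
  (List.range ((cells.sup fun c => max c.1 c.2) + 1)).flatMap fun j =>
    ((List.range ((cells.sup fun c => max c.1 c.2) + 1)).reverse).flatMap fun i =>
      (T.entry (i, j)).sort (· ≤ ·)

end SVT

/-- The stable Grothendieck polynomial of the shape given by `cells`, in the
variables `x_1, …, x_m` (`0`-based: variables `0, …, m-1`):
`G(cells) = ∑_T (-1)^(|T| - #cells) x^T` over set-valued tableaux `T` of shape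
`cells` with entries in `{1, …, m}`. -/
noncomputable def grothendieck (cells : Finset (ℕ × ℕ)) (m : ℕ) : MvPolynomial ℕ ℤ :=
  ∑ᶠ (T : SVT cells) (_ : T.Bounded m), ((-1 : ℤ) ^ (T.size - cells.card)) • T.monomial

/-- A reverse lattice word: every suffix contains, for each `i`, at least as
many occurrences of `i` as of `i + 1`. -/
def IsRLW (w : List ℕ) : Prop := ∀ s, s <:+ w → ∀ i, s.count (i + 1) ≤ s.count i

/-- A partial reverse lattice word with respect to the (`0`-based, half-open)
interval `[a, b)`:  every suffix contains, for each `t` with `a ≤ t` and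
`t + 1 < b`, at least as many occurrences of `t` as of `t + 1`. -/
def IsPartialRLW (a b : ℕ) (w : List ℕ) : Prop :=
  ∀ s, s <:+ w → ∀ t, a ≤ t → t + 1 < b → s.count (t + 1) ≤ s.count t

/-- `w` has content `ν`: the number of occurrences of `i` in `w` is the length
of the `i`-th row of `ν`. -/
def HasContent (w : List ℕ) (nu : YoungDiagram) : Prop := ∀ i, w.count i = nu.rowLen i

/-- The cells of the skew diagram `λ * μ`, obtained by placing `λ` and `μ`
corner to corner: `λ` occupies rows `0, …, ℓ(λ)-1` shifted right by `μ₁`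
columns, and `μ` occupies the rows below row `ℓ(λ)-1`. -/
def starCells (lam mu : YoungDiagram) : Finset (ℕ × ℕ) :=
  (lam.cells.image fun c => (c.1, c.2 + mu.rowLen 0)) ∪
    (mu.cells.image fun c => (c.1 + lam.colLen 0, c.2))

/-- The structure constant `c^ν_{λμ}`: `(-1)^(|ν|-|λ|-|μ|)` times the number of
set-valued tableaux of shape `λ * μ` whose word is a reverse lattice word with
content `ν`. -/
noncomputable def cLR (lam mu nu : YoungDiagram) : ℤ :=
  (-1 : ℤ) ^ (nu.card - lam.card - mu.card) *
    (Nat.card {T : SVT (starCells lam mu) // IsRLW T.word ∧ HasContent T.word nu} : ℤ)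

/-- The coproduct structure constant `d^ν_{λμ}`: `(-1)^(|λ|+|μ|-|ν|)` times the
number of set-valued tableaux of shape `ν` whose word is a partial reverse
lattice word with respect to both intervals `[1, ℓ(λ)]` and
`[ℓ(λ)+1, ℓ(λ)+ℓ(μ)]` and has content `(λ₁, …, λ_{ℓ(λ)}, μ₁, …, μ_{ℓ(μ)})`. -/
noncomputable def dCoeff (lam mu nu : YoungDiagram) : ℤ :=
  (-1 : ℤ) ^ (lam.card + mu.card - nu.card) *
    (Nat.card {T : SVT nu.cells //
      IsPartialRLW 0 (lam.colLen 0) T.word ∧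
      IsPartialRLW (lam.colLen 0) (lam.colLen 0 + mu.colLen 0) T.word ∧
      ∀ i, T.word.count i =
        if i < lam.colLen 0 then lam.rowLen i else mu.rowLen (i - lam.colLen 0)} : ℤ)

/-- The coefficient `α_{θ,μ}` for a shape `θ` given by `cells`:
`(-1)^(|μ|-|θ|)` times the number of set-valued tableaux of shape `θ` whose
word is a reverse lattice word with content `μ`. -/
noncomputable def alphaCoeff (cells : Finset (ℕ × ℕ)) (mu : YoungDiagram) : ℤ :=
  (-1 : ℤ) ^ (mu.card - cells.card) *
    (Nat.card {T : SVT cells // IsRLW T.word ∧ HasContent T.word mu} : ℤ)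

/-- `ν/λ` is a vertical strip: at most one box in each row. -/
def IsVerticalStrip (lam nu : YoungDiagram) : Prop := ∀ i, nu.rowLen i ≤ lam.rowLen i + 1

/-- `ν/λ` is a horizontal strip: at most one box in each column. -/
def IsHorizontalStrip (lam nu : YoungDiagram) : Prop := ∀ j, nu.colLen j ≤ lam.colLen j + 1

/-- A set of boxes is a rook strip if it has at most one box in each row and in
each column. -/
def IsRookStripCells (s : Finset (ℕ × ℕ)) : Prop :=
  (∀ i, (s.filter fun c => c.1 = i).card ≤ 1) ∧ (∀ j, (s.filter fun c => c.2 = j).card ≤ 1)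

/-- The rectangular Young diagram with `p` rows and `q` columns. -/
def rect (p q : ℕ) : YoungDiagram :=
  ⟨Finset.range p ×ˢ Finset.range q, by
    intro a b hba ha
    simp only [Finset.coe_product, Set.mem_prod, Finset.mem_coe, Finset.mem_range] at ha ⊢
    exact ⟨lt_of_le_of_lt hba.1 ha.1, lt_of_le_of_lt hba.2 ha.2⟩⟩

namespace SVT

variable {S : Finset (ℕ × ℕ)}

theorem mem_cells (T : SVT S) {c : ℕ × ℕ} {x : ℕ} (hx : x ∈ T.entry c) : c ∈ S := by
  by_contra h
  simp [T.eq_empty_of_not_mem c h] at hx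

theorem ext_entry {T T' : SVT S} (h : ∀ c x, x ∈ T.entry c ↔ x ∈ T'.entry c) : T = T' := by
  have : T.entry = T'.entry := funext fun c => Finset.ext (h c)
  cases T; cases T'; simpa using this

theorem row_le (hS : (S : Set (ℕ × ℕ)).OrdConnected) (T : SVT S) {r j j' x y : ℕ} (hj : j < j')
    (hx : x ∈ T.entry (r, j)) (hy : y ∈ T.entry (r, j')) : x ≤ y := by
  induction j', hj using Nat.le_induction generalizing y with
  | base => exact T.row_weak r j (T.mem_cells hx) (T.mem_cells hy) x hx y hy
  | succ k hk ih =>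
    have hc : (r, k) ∈ S := hS.out (T.mem_cells hx) (T.mem_cells hy)
      ⟨⟨le_rfl, by simp; omega⟩, ⟨le_rfl, by simp⟩⟩
    obtain ⟨z, hz⟩ := T.nonempty_of_mem _ hc
    exact (ih hz).trans (T.row_weak r k hc (T.mem_cells hy) z hz y hy)

theorem col_lt (hS : (S : Set (ℕ × ℕ)).OrdConnected) (T : SVT S) {r r' j x y : ℕ} (hr : r < r')
    (hx : x ∈ T.entry (r, j)) (hy : y ∈ T.entry (r', j)) : x < y := by
  induction r', hr using Nat.le_induction generalizing y with
  | base => exact T.col_strict r j (T.mem_cells hx) (T.mem_cells hy) x hx y hy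
  | succ k hk ih =>
    have hc : (k, j) ∈ S := hS.out (T.mem_cells hx) (T.mem_cells hy)
      ⟨⟨by simp; omega, le_rfl⟩, ⟨by simp, le_rfl⟩⟩
    obtain ⟨z, hz⟩ := T.nonempty_of_mem _ hc
    exact (ih hz).trans (T.col_strict k j hc (T.mem_cells hy) z hz y hy)

end SVT

/-- The order-reversing map of a finite interval `F` of natural numbers. -/
noncomputable def flipIn (F : Finset ℕ) (j : ℕ) : ℕ := sInf (F : Set ℕ) + F.sup id - j

section flipIn

variable {F : Finset ℕ} {j j' : ℕ}

theorem sInf_le_of_mem_of_le_sup (hj : j ∈ F) : sInf (F : Set ℕ) ≤ j ∧ j ≤ F.sup id :=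
  ⟨Nat.sInf_le hj, Finset.le_sup (f := id) hj⟩

theorem flipIn_mem (hF : ∀ a ∈ F, ∀ b ∈ F, ∀ c, a ≤ c → c ≤ b → c ∈ F) (hj : j ∈ F) :
    flipIn F j ∈ F := by
  have h1 := sInf_le_of_mem_of_le_sup hj
  have h2 : sInf (F : Set ℕ) ∈ F := Nat.sInf_mem (s := (F : Set ℕ)) ⟨j, hj⟩
  obtain ⟨k, hk, hk'⟩ := Finset.exists_mem_eq_sup F ⟨j, hj⟩ id
  have hk'' : F.sup id = k := hk'
  refine hF _ h2 k hk _ ?_ ?_ <;> unfold flipIn <;> omega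

theorem flipIn_flipIn (hj : j ∈ F) : flipIn F (flipIn F j) = j := by
  have h1 := sInf_le_of_mem_of_le_sup hj
  unfold flipIn; omega

theorem flipIn_lt (hj : j ∈ F) (hj' : j' ∈ F) (h : j < j') : flipIn F j' < flipIn F j := by
  have h1 := sInf_le_of_mem_of_le_sup hj
  have h2 := sInf_le_of_mem_of_le_sup hj'
  unfold flipIn; omega

end flipIn

namespace SVT

variable {S : Finset (ℕ × ℕ)}

/-- A box containing `i` or `i + 1` which is not part of a vertical pair `i` over `i + 1`. -/
def IsFree (T : SVT S) (i : ℕ) (c : ℕ × ℕ) : Prop :=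
  (i ∈ T.entry c ∨ i + 1 ∈ T.entry c) ∧ (∀ r, r + 1 = c.1 → i ∉ T.entry (r, c.2)) ∧
    i + 1 ∉ T.entry (c.1 + 1, c.2)

open scoped Classical in
/-- The columns below `J` of the free boxes of row `r`. -/
noncomputable def freeCols (T : SVT S) (i J r : ℕ) : Finset ℕ :=
  (Finset.range J).filter fun j => T.IsFree i (r, j)

theorem mem_freeCols {T : SVT S} {i J r j : ℕ} :
    j ∈ T.freeCols i J r ↔ j < J ∧ T.IsFree i (r, j) := by
  simp [freeCols]

theorem free_of_left_of_free (hS : (S : Set (ℕ × ℕ)).OrdConnected) (T : SVT S) {i r j j' : ℕ}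
    (hj : j < j') (h : T.IsFree i (r, j')) (hb : i + 1 ∈ T.entry (r, j)) : T.IsFree i (r, j) := by
  refine ⟨Or.inr hb, ?_, ?_⟩
  · rintro p rfl hp
    obtain ⟨h1, h2, -⟩ := h
    have hc : (p, j') ∈ S := by
      obtain ⟨y, hy⟩ : ∃ y, y ∈ T.entry (p + 1, j') := h1.elim (fun h => ⟨_, h⟩) (fun h => ⟨_, h⟩)
      exact hS.out (T.mem_cells hp) (T.mem_cells hy)
        ⟨⟨le_rfl, by simp; omega⟩, ⟨by simp, le_rfl⟩⟩
    obtain ⟨z, hz⟩ := T.nonempty_of_mem _ hc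
    have h3 := T.row_le hS hj hp hz
    have h4 : z < i + 1 := by
      rcases h1 with h1 | h1
      · have := T.col_lt hS (Nat.lt_succ_self p) hz h1; omega
      · exact T.col_lt hS (Nat.lt_succ_self p) hz h1
    exact h2 p rfl ((show z = i by omega) ▸ hz)
  · intro h3
    have := T.col_lt hS (Nat.lt_succ_self r) hb h3
    omega

theorem free_of_right_of_free (hS : (S : Set (ℕ × ℕ)).OrdConnected) (T : SVT S) {i r j j' : ℕ}
    (hj : j < j') (h : T.IsFree i (r, j)) (ha : i ∈ T.entry (r, j')) : T.IsFree i (r, j') := by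
  refine ⟨Or.inl ha, ?_, ?_⟩
  · rintro p rfl hp
    have := T.col_lt hS (Nat.lt_succ_self p) hp ha
    omega
  · intro hp
    obtain ⟨h1, -, h2⟩ := h
    have hc : (r + 1, j) ∈ S := by
      obtain ⟨y, hy⟩ : ∃ y, y ∈ T.entry (r, j) := h1.elim (fun h => ⟨_, h⟩) (fun h => ⟨_, h⟩)
      exact hS.out (T.mem_cells hy) (T.mem_cells hp)
        ⟨⟨by simp, le_rfl⟩, ⟨le_rfl, by simp; omega⟩⟩
    obtain ⟨z, hz⟩ := T.nonempty_of_mem _ hc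
    have h3 := T.row_le hS hj hz hp
    have h4 : i < z := by
      rcases h1 with h1 | h1
      · exact T.col_lt hS (Nat.lt_succ_self r) h1 hz
      · have := T.col_lt hS (Nat.lt_succ_self r) h1 hz; omega
    exact h2 ((show z = i + 1 by omega) ▸ hz)

theorem freeCols_convex (hS : (S : Set (ℕ × ℕ)).OrdConnected) (T : SVT S) (i J r : ℕ) :
    ∀ a ∈ T.freeCols i J r, ∀ b ∈ T.freeCols i J r, ∀ c, a ≤ c → c ≤ b →
      c ∈ T.freeCols i J r := by
  intro a ha b hb c hac hcb
  rcases hac.eq_or_lt with rfl | hac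
  · exact ha
  rcases hcb.eq_or_lt with rfl | hcb
  · exact hb
  rw [mem_freeCols] at *
  refine ⟨by omega, ?_⟩
  obtain ⟨x, hx, hx'⟩ : ∃ x, x ∈ T.entry (r, a) ∧ i ≤ x :=
    ha.2.1.elim (fun h => ⟨_, h, le_rfl⟩) (fun h => ⟨_, h, by simp⟩)
  obtain ⟨y, hy, hy'⟩ : ∃ y, y ∈ T.entry (r, b) ∧ y ≤ i + 1 :=
    hb.2.1.elim (fun h => ⟨_, h, by simp⟩) (fun h => ⟨_, h, by simp⟩)
  have hc : (r, c) ∈ S := hS.out (T.mem_cells hx) (T.mem_cells hy)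
    ⟨⟨le_rfl, hac.le⟩, ⟨le_rfl, hcb.le⟩⟩
  obtain ⟨z, hz⟩ := T.nonempty_of_mem _ hc
  have h1 := T.row_le hS hac hx hz
  have h2 := T.row_le hS hcb hz hy
  rcases (show z = i ∨ z = i + 1 by omega) with rfl | rfl
  · exact T.free_of_right_of_free hS hac ha.2 hz
  · exact T.free_of_left_of_free hS hcb hb.2 hz

open scoped Classical in
/-- The entries of the Bender–Knuth involution exchanging `i` and `i + 1` in the columns
below `J`: in every row the free part is reversed and its letters are exchanged. -/
noncomputable def bkEntry (T : SVT S) (i J : ℕ) (c : ℕ × ℕ) : Finset ℕ :=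
  if c.2 < J ∧ T.IsFree i c then
    (T.entry c \ {i, i + 1}) ∪
      (T.entry (c.1, flipIn (T.freeCols i J c.1) c.2) ∩ {i, i + 1}).image
        (Equiv.swap i (i + 1))
  else T.entry c

theorem mem_bkEntry_of_free {T : SVT S} {i J x : ℕ} {c : ℕ × ℕ} (hJ : c.2 < J)
    (hc : T.IsFree i c) :
    x ∈ T.bkEntry i J c ↔ (x ≠ i ∧ x ≠ i + 1 ∧ x ∈ T.entry c) ∨
      (x = i ∧ i + 1 ∈ T.entry (c.1, flipIn (T.freeCols i J c.1) c.2)) ∨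
      (x = i + 1 ∧ i ∈ T.entry (c.1, flipIn (T.freeCols i J c.1) c.2)) := by
  rw [bkEntry, if_pos ⟨hJ, hc⟩]
  simp only [Finset.mem_union, Finset.mem_sdiff, Finset.mem_insert, Finset.mem_singleton,
    Finset.mem_image, Finset.mem_inter]
  constructor
  · rintro (h | ⟨y, ⟨hy, rfl | rfl⟩, rfl⟩)
    · tauto
    · simp [hy]
    · simp [hy]
  · rintro (h | ⟨rfl, h⟩ | ⟨rfl, h⟩)
    · tauto
    · exact Or.inr ⟨x + 1, ⟨h, by simp⟩, by simp⟩
    · exact Or.inr ⟨i, ⟨h, by simp⟩, by simp⟩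

theorem bkEntry_of_not {T : SVT S} {i J : ℕ} {c : ℕ × ℕ} (h : ¬ (c.2 < J ∧ T.IsFree i c)) :
    T.bkEntry i J c = T.entry c := if_neg h

theorem isFree_flip (hS : (S : Set (ℕ × ℕ)).OrdConnected) {T : SVT S} {i J : ℕ} {c : ℕ × ℕ}
    (hJ : c.2 < J) (hc : T.IsFree i c) :
    flipIn (T.freeCols i J c.1) c.2 < J ∧
      T.IsFree i (c.1, flipIn (T.freeCols i J c.1) c.2) :=
  mem_freeCols.1 (flipIn_mem (T.freeCols_convex hS i J c.1) (mem_freeCols.2 ⟨hJ, hc⟩))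

/-- The condition that column `J` does not obstruct the Bender–Knuth involution. -/
def BKCompat (T : SVT S) (i J : ℕ) : Prop :=
  ∀ r j, j < J → T.IsFree i (r, j) → ∀ y ∈ T.entry (r, J), i + 1 ≤ y

/-- The Bender–Knuth involution in the columns below `J`. -/
noncomputable def bk (hS : (S : Set (ℕ × ℕ)).OrdConnected) (T : SVT S) (i J : ℕ)
    (H : T.BKCompat i J) : SVT S where
  entry := T.bkEntry i J
  nonempty_of_mem c hc := by
    by_cases h : c.2 < J ∧ T.IsFree i c
    · have h2 := (isFree_flip hS h.1 h.2).2.1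
      rcases h2 with h2 | h2
      · exact ⟨i + 1, (mem_bkEntry_of_free h.1 h.2).2 (by simp [h2])⟩
      · exact ⟨i, (mem_bkEntry_of_free h.1 h.2).2 (by simp [h2])⟩
    · rw [bkEntry_of_not h]
      exact T.nonempty_of_mem c hc
  eq_empty_of_not_mem c hc := by
    rw [bkEntry_of_not, T.eq_empty_of_not_mem c hc]
    rintro ⟨-, h, -⟩
    exact hc (h.elim T.mem_cells T.mem_cells)
  row_weak r j h1 h2 x hx y hy := by
    by_cases f1 : j < J ∧ T.IsFree i (r, j)
    · by_cases f2 : j + 1 < J ∧ T.IsFree i (r, j + 1)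
      · rw [mem_bkEntry_of_free f1.1 f1.2] at hx
        rw [mem_bkEntry_of_free f2.1 f2.2] at hy
        have hlt := flipIn_lt (mem_freeCols.2 f1) (mem_freeCols.2 f2) (Nat.lt_succ_self j)
        have hw := fun a ha b hb => T.row_weak r j h1 h2 a ha b hb
        simp only at hx hy
        rcases hx with ⟨hx1, hx2, hx⟩ | ⟨rfl, hx⟩ | ⟨rfl, hx⟩ <;>
          rcases hy with ⟨hy1, hy2, hy⟩ | ⟨rfl, hy⟩ | ⟨rfl, hy⟩
        · exact hw x hx y hy
        · have := f2.2.1.elim (fun h => (hw x hx _ h).trans (Nat.le_succ _)) (hw x hx _); omega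
        · have := f2.2.1.elim (fun h => (hw x hx _ h).trans (Nat.le_succ _)) (hw x hx _); omega
        · have := f1.2.1.elim (hw _ · y hy) (fun h => (Nat.le_succ _).trans (hw _ h y hy)); omega
        · rfl
        · simp
        · have := f1.2.1.elim (hw _ · y hy) (fun h => (Nat.le_succ _).trans (hw _ h y hy)); omega
        · exact T.row_le hS hlt hy hx
        · rfl
      · rw [mem_bkEntry_of_free f1.1 f1.2] at hx
        rw [bkEntry_of_not f2] at hy
        have hw := fun a ha => T.row_weak r j h1 h2 a ha y hy
        rcases hx with ⟨-, -, hx⟩ | ⟨rfl, -⟩ | ⟨rfl, -⟩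
        · exact hw x hx
        · exact f1.2.1.elim (hw _) (fun h => (Nat.le_succ _).trans (hw _ h))
        · have h3 : i ≤ y := f1.2.1.elim (hw _) (fun h => (Nat.le_succ _).trans (hw _ h))
          rcases (Nat.succ_le_of_lt f1.1).eq_or_lt with h4 | h4
          · exact H r j f1.1 f1.2 y (h4 ▸ hy)
          · rcases h3.eq_or_lt with rfl | h3
            · exact absurd ⟨h4, T.free_of_right_of_free hS (Nat.lt_succ_self j) f1.2 hy⟩ f2
            · exact h3
    · rw [bkEntry_of_not f1] at hx
      by_cases f2 : j + 1 < J ∧ T.IsFree i (r, j + 1)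
      · rw [mem_bkEntry_of_free f2.1 f2.2] at hy
        have hw := fun a ha => T.row_weak r j h1 h2 x hx a ha
        have h3 : x ≤ i + 1 := f2.2.1.elim (fun h => (hw _ h).trans (Nat.le_succ _)) (hw _)
        rcases hy with ⟨-, -, hy⟩ | ⟨rfl, -⟩ | ⟨rfl, -⟩
        · exact hw y hy
        · rcases h3.eq_or_lt with rfl | h3
          · exact absurd ⟨by omega, T.free_of_left_of_free hS (Nat.lt_succ_self j) f2.2 hx⟩ f1
          · omega
        · exact h3
      · rw [bkEntry_of_not f2] at hy
        exact T.row_weak r j h1 h2 x hx y hy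
  col_strict r j h1 h2 x hx y hy := by
    have hw := fun a ha b hb => T.col_strict r j h1 h2 a ha b hb
    by_cases f1 : j < J ∧ T.IsFree i (r, j)
    · have h3 : ∀ z ∈ T.entry (r + 1, j), i + 1 < z := by
        intro z hz
        have : i < z := f1.2.1.elim (hw _ · z hz) (fun h => (Nat.lt_succ_self _).trans (hw _ h z hz))
        rcases (Nat.succ_le_of_lt this).eq_or_lt with rfl | h
        · exact absurd hz f1.2.2.2
        · exact h
      have f2 : ¬ (j < J ∧ T.IsFree i (r + 1, j)) := by
        rintro ⟨-, h | h, -⟩ <;> have := h3 _ h <;> omega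
      rw [mem_bkEntry_of_free f1.1 f1.2] at hx
      rw [bkEntry_of_not f2] at hy
      rcases hx with ⟨-, -, hx⟩ | ⟨rfl, -⟩ | ⟨rfl, -⟩
      · exact hw x hx y hy
      · have := h3 y hy; omega
      · exact h3 y hy
    · rw [bkEntry_of_not f1] at hx
      by_cases f2 : j < J ∧ T.IsFree i (r + 1, j)
      · have h3 : x < i := by
          have : x < i + 1 := f2.2.1.elim (fun h => (hw x hx _ h).trans (Nat.lt_succ_self _))
            (hw x hx _)
          rcases (Nat.le_of_lt_succ this).eq_or_lt with rfl | h
          · exact absurd hx (f2.2.2.1 r rfl)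
          · exact h
        rw [mem_bkEntry_of_free f2.1 f2.2] at hy
        rcases hy with ⟨-, -, hy⟩ | ⟨rfl, -⟩ | ⟨rfl, -⟩
        · exact hw x hx y hy
        · exact h3
        · omega
      · rw [bkEntry_of_not f2] at hy
        exact hw x hx y hy

end SVT

/-- The number of boxes in the columns below `J` that contain `t`. -/
def SVT.wtBelow {S : Finset (ℕ × ℕ)} (T : SVT S) (J t : ℕ) : ℕ :=
  (S.filter fun c => t ∈ T.entry c ∧ c.2 < J).card

/-- The number of boxes that contain `t`. -/
def SVT.wt {S : Finset (ℕ × ℕ)} (T : SVT S) (t : ℕ) : ℕ := (S.filter fun c => t ∈ T.entry c).card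

namespace SVT

variable {S : Finset (ℕ × ℕ)} (hS : (S : Set (ℕ × ℕ)).OrdConnected) {T : SVT S} {i J : ℕ}

theorem bk_entry (H : T.BKCompat i J) (c : ℕ × ℕ) : (T.bk hS i J H).entry c = T.bkEntry i J c :=
  rfl

theorem bk_entry_of_le (H : T.BKCompat i J) {c : ℕ × ℕ} (hc : J ≤ c.2) :
    (T.bk hS i J H).entry c = T.entry c :=
  bkEntry_of_not fun h => by omega

theorem isFree_bk (H : T.BKCompat i J) (c : ℕ × ℕ) :
    (T.bk hS i J H).IsFree i c ↔ T.IsFree i c := by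
  obtain ⟨r, j⟩ := c
  by_cases hj : j < J
  swap
  · have hj : J ≤ j := not_lt.1 hj
    simp [IsFree, bk_entry_of_le hS H, hj]
  constructor
  · intro h
    by_contra hn
    have hn' : ¬ (j < J ∧ T.IsFree i (r, j)) := fun h => hn h.2
    obtain ⟨h1, h2, h3⟩ := h
    rw [bk_entry, bkEntry_of_not hn'] at h1
    refine hn ⟨h1, ?_, ?_⟩
    · rintro p rfl hp
      refine h2 p rfl ?_
      rw [bk_entry, bkEntry_of_not]
      · exact hp
      rintro ⟨-, -, -, h4⟩
      refine h1.elim (fun h => ?_) h4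
      have := T.col_lt hS (Nat.lt_succ_self p) hp h
      omega
    · intro hp
      refine h3 ?_
      rw [bk_entry, bkEntry_of_not]
      · exact hp
      rintro ⟨-, -, h4, -⟩
      refine h1.elim (fun h => h4 r rfl h) (fun h => ?_)
      have := T.col_lt hS (Nat.lt_succ_self r) h hp
      omega
  · intro h
    have h' := h
    obtain ⟨h1, h2, h3⟩ := h
    refine ⟨?_, ?_, ?_⟩
    · rw [bk_entry, mem_bkEntry_of_free hj h', mem_bkEntry_of_free hj h']
      have := (isFree_flip hS hj h').2.1
      simp only at this ⊢
      tauto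
    · rintro p rfl
      rw [bk_entry, bkEntry_of_not]
      · exact h2 p rfl
      rintro ⟨-, h4 | h4, -⟩
      · exact h2 p rfl h4
      · rcases h1 with h1 | h1 <;> have := T.col_lt hS (Nat.lt_succ_self p) h4 h1 <;> omega
    · rw [bk_entry, bkEntry_of_not]
      · exact h3
      rintro ⟨-, h4 | h4, -⟩
      · have := h1.elim (T.col_lt hS (Nat.lt_succ_self r) · h4)
          (fun h => (Nat.lt_succ_self i).trans (T.col_lt hS (Nat.lt_succ_self r) h h4))
        omega
      · exact h3 h4

theorem freeCols_bk (H : T.BKCompat i J) (r : ℕ) :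
    (T.bk hS i J H).freeCols i J r = T.freeCols i J r := by
  ext j
  simp only [mem_freeCols, isFree_bk]

theorem bkCompat_bk (H : T.BKCompat i J) : (T.bk hS i J H).BKCompat i J := by
  intro r j hj hf y hy
  rw [bk_entry_of_le hS H le_rfl] at hy
  exact H r j hj ((isFree_bk hS H _).1 hf) y hy

theorem mem_bk_of_free (H : T.BKCompat i J) {c : ℕ × ℕ} {x : ℕ} (hJ : c.2 < J)
    (hc : T.IsFree i c) :
    x ∈ (T.bk hS i J H).entry c ↔ (x ≠ i ∧ x ≠ i + 1 ∧ x ∈ T.entry c) ∨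
      (x = i ∧ i + 1 ∈ T.entry (c.1, flipIn (T.freeCols i J c.1) c.2)) ∨
      (x = i + 1 ∧ i ∈ T.entry (c.1, flipIn (T.freeCols i J c.1) c.2)) :=
  mem_bkEntry_of_free hJ hc

theorem mem_bk_of_not (H : T.BKCompat i J) {c : ℕ × ℕ} {x : ℕ} (hc : ¬ (c.2 < J ∧ T.IsFree i c)) :
    x ∈ (T.bk hS i J H).entry c ↔ x ∈ T.entry c := by
  rw [bk_entry, bkEntry_of_not hc]

theorem mem_bk_of_ne (H : T.BKCompat i J) {c : ℕ × ℕ} {x : ℕ} (h1 : x ≠ i) (h2 : x ≠ i + 1) :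
    x ∈ (T.bk hS i J H).entry c ↔ x ∈ T.entry c := by
  by_cases hc : c.2 < J ∧ T.IsFree i c
  · rw [mem_bk_of_free hS H hc.1 hc.2]; tauto
  · exact mem_bk_of_not hS H hc

theorem bk_bk (H : T.BKCompat i J) :
    (T.bk hS i J H).bk hS i J (bkCompat_bk hS H) = T := by
  apply ext_entry
  intro c x
  by_cases hc : c.2 < J ∧ T.IsFree i c
  · obtain ⟨h1, h2⟩ := hc
    have h3 := isFree_flip hS h1 h2
    rw [mem_bk_of_free hS _ h1 ((isFree_bk hS H c).2 h2), freeCols_bk,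
      mem_bk_of_free hS H h1 h2, mem_bk_of_free hS H h3.1 h3.2, mem_bk_of_free hS H h3.1 h3.2]
    simp only [flipIn_flipIn (mem_freeCols.2 ⟨h1, h2⟩), Prod.mk.eta]
    grind
  · rw [mem_bk_of_not, mem_bk_of_not _ _ hc]
    rwa [isFree_bk]

theorem mem_bk_self_or (H : T.BKCompat i J) {c : ℕ × ℕ} {x : ℕ}
    (hx : x ∈ (T.bk hS i J H).entry c) : x = i ∨ x = i + 1 ∨ x ∈ T.entry c := by
  by_cases hc : c.2 < J ∧ T.IsFree i c
  · rw [mem_bk_of_free hS H hc.1 hc.2] at hx; tauto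
  · rw [mem_bk_of_not hS H hc] at hx; tauto

theorem wt_bk_of_ne (H : T.BKCompat i J) {t : ℕ} (h1 : t ≠ i) (h2 : t ≠ i + 1) :
    (T.bk hS i J H).wt t = T.wt t := by
  simp only [wt, mem_bk_of_ne hS H h1 h2]

open scoped Classical in
theorem wtBelow_bk_left (H : T.BKCompat i J) :
    (T.bk hS i J H).wtBelow J i = T.wtBelow J (i + 1) := by
  unfold wtBelow
  refine Finset.card_nbij'
    (fun c => if T.IsFree i c then (c.1, flipIn (T.freeCols i J c.1) c.2) else (c.1 + 1, c.2))
    (fun c => if T.IsFree i c then (c.1, flipIn (T.freeCols i J c.1) c.2) else (c.1 - 1, c.2))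
    ?_ ?_ ?_ ?_
  · intro c hc
    simp only [Finset.coe_filter, Set.mem_ofPred_eq] at hc ⊢
    obtain ⟨-, h1, h2⟩ := hc
    split_ifs with hf
    · have h3 := isFree_flip hS h2 hf
      rw [mem_bk_of_free hS H h2 hf] at h1
      have h4 : i + 1 ∈ T.entry (c.1, flipIn (T.freeCols i J c.1) c.2) := by
        simpa using h1
      exact ⟨T.mem_cells h4, h4, h3.1⟩
    · rw [mem_bk_of_not hS H (by tauto)] at h1
      have h4 : i + 1 ∈ T.entry (c.1 + 1, c.2) := by
        by_contra h5
        refine hf ⟨Or.inl h1, ?_, h5⟩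
        intro r hr h6
        have := T.col_lt hS (show r < c.1 by omega) h6 h1
        omega
      exact ⟨T.mem_cells h4, h4, h2⟩
  · intro c hc
    simp only [Finset.coe_filter, Set.mem_ofPred_eq] at hc ⊢
    obtain ⟨-, h1, h2⟩ := hc
    split_ifs with hf
    · have h3 := isFree_flip hS h2 hf
      have h4 : i ∈ (T.bk hS i J H).entry (c.1, flipIn (T.freeCols i J c.1) c.2) := by
        rw [mem_bk_of_free hS H h3.1 h3.2]
        simp [flipIn_flipIn (mem_freeCols.2 ⟨h2, hf⟩), h1]
      exact ⟨mem_cells _ h4, h4, h3.1⟩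
    · have h4 : ∃ r, r + 1 = c.1 ∧ i ∈ T.entry (r, c.2) := by
        by_contra h5
        push Not at h5
        refine hf ⟨Or.inr h1, h5, ?_⟩
        intro h6
        have := T.col_lt hS (show c.1 < c.1 + 1 by omega) h1 h6
        omega
      obtain ⟨r, hr, h5⟩ := h4
      have h6 : c.1 - 1 = r := by omega
      rw [h6]
      have h7 : ¬ T.IsFree i (r, c.2) := fun h => h.2.2 (by simpa [hr] using h1)
      have h8 : i ∈ (T.bk hS i J H).entry (r, c.2) := by
        rwa [mem_bk_of_not hS H (by tauto)]
      exact ⟨mem_cells _ h8, h8, h2⟩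
  · intro c hc
    simp only [Finset.coe_filter, Set.mem_ofPred_eq] at hc ⊢
    obtain ⟨-, h1, h2⟩ := hc
    by_cases hf : T.IsFree i c
    · rw [if_pos hf, if_pos (isFree_flip hS h2 hf).2]
      simp [flipIn_flipIn (mem_freeCols.2 ⟨h2, hf⟩)]
    · rw [if_neg hf, if_neg]
      · simp
      rw [mem_bk_of_not hS H (by tauto)] at h1
      exact fun h => h.2.1 _ rfl h1
  · intro c hc
    simp only [Finset.coe_filter, Set.mem_ofPred_eq] at hc ⊢
    obtain ⟨-, h1, h2⟩ := hc
    by_cases hf : T.IsFree i c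
    · rw [if_pos hf, if_pos (isFree_flip hS h2 hf).2]
      simp [flipIn_flipIn (mem_freeCols.2 ⟨h2, hf⟩)]
    · have h4 : ∃ r, r + 1 = c.1 ∧ i ∈ T.entry (r, c.2) := by
        by_contra h5
        push Not at h5
        refine hf ⟨Or.inr h1, h5, ?_⟩
        intro h6
        have := T.col_lt hS (show c.1 < c.1 + 1 by omega) h1 h6
        omega
      obtain ⟨r, hr, h5⟩ := h4
      have h6 : c.1 - 1 = r := by omega
      rw [if_neg hf, h6, if_neg]
      · simp [hr]
      · exact fun h => h.2.2 (by simpa [hr] using h1)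

theorem wtBelow_bk_right (H : T.BKCompat i J) :
    (T.bk hS i J H).wtBelow J (i + 1) = T.wtBelow J i := by
  rw [← wtBelow_bk_left hS (bkCompat_bk hS H), bk_bk]

/-- The number of boxes in the columns from `J` on that contain `t`. -/
def wtFrom (T : SVT S) (J t : ℕ) : ℕ := (S.filter fun c => t ∈ T.entry c ∧ J ≤ c.2).card

theorem wtBelow_add_wtFrom (T : SVT S) (J t : ℕ) : T.wtBelow J t + T.wtFrom J t = T.wt t := by
  unfold wtBelow wtFrom wt
  rw [← Finset.filter_filter, ← Finset.filter_filter, ← Finset.card_filter_add_card_filter_not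
    (s := S.filter fun c => t ∈ T.entry c) (fun c => c.2 < J)]
  simp only [not_lt]

theorem wtFrom_bk (H : T.BKCompat i J) (t : ℕ) :
    (T.bk hS i J H).wtFrom J t = T.wtFrom J t := by
  unfold wtFrom
  congr 1
  apply Finset.filter_congr
  intro c _
  constructor <;> rintro ⟨h1, h2⟩
  · rw [bk_entry_of_le hS H h2] at h1
    exact ⟨h1, h2⟩
  · exact ⟨by rwa [bk_entry_of_le hS H h2], h2⟩

theorem wt_bk_left (H : T.BKCompat i J) :
    (T.bk hS i J H).wt i = T.wtBelow J (i + 1) + T.wtFrom J i := by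
  rw [← wtBelow_add_wtFrom _ J, wtBelow_bk_left, wtFrom_bk]

theorem wt_bk_right (H : T.BKCompat i J) :
    (T.bk hS i J H).wt (i + 1) = T.wtBelow J i + T.wtFrom J (i + 1) := by
  rw [← wtBelow_add_wtFrom _ J, wtBelow_bk_right, wtFrom_bk]

theorem bounded_bk (H : T.BKCompat i J) {m : ℕ} (hi : i + 1 < m) (hT : T.Bounded m) :
    (T.bk hS i J H).Bounded m := by
  intro c x hx
  rcases mem_bk_self_or hS H hx with rfl | rfl | hx
  · omega
  · omega
  · exact hT c x hx

theorem size_eq_sum_wt {m : ℕ} (hT : T.Bounded m) : T.size = ∑ t : Fin m, T.wt t := by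
  rw [Fin.sum_univ_eq_sum_range (fun t => T.wt t)]
  unfold size wt
  simp only [Finset.card_eq_sum_ones]
  refine Finset.sum_comm' ?_
  intro c t
  simp only [Finset.mem_filter, Finset.mem_range]
  constructor
  · exact fun h => ⟨h, hT c t h.2⟩
  · exact fun h => h.1

theorem monomial_eq_prod_wt {m : ℕ} (hT : T.Bounded m) :
    T.monomial = ∏ t : Fin m, (X (t : ℕ) : MvPolynomial ℕ ℤ) ^ T.wt t := by
  rw [Fin.prod_univ_eq_prod_range (fun t => (X t : MvPolynomial ℕ ℤ) ^ T.wt t)]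
  unfold SVT.monomial wt
  simp only [← Finset.prod_const]
  refine Finset.prod_comm' ?_
  intro c t
  simp only [Finset.mem_filter, Finset.mem_range]
  constructor
  · exact fun h => ⟨h, hT c t h.2⟩
  · exact fun h => h.1

theorem card_le_size (T : SVT S) : S.card ≤ T.size := by
  rw [Finset.card_eq_sum_ones]
  exact Finset.sum_le_sum fun c hc => Finset.card_pos.2 (T.nonempty_of_mem c hc)

end SVT

/-- The sign of a set-valued tableau. -/
def SVT.sgn {S : Finset (ℕ × ℕ)} (T : SVT S) : ℤ := (-1) ^ (T.size - S.card)

theorem SVT.finite_bounded (S : Finset (ℕ × ℕ)) (m : ℕ) : {T : SVT S | T.Bounded m}.Finite := by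
  let f : {T : SVT S | T.Bounded m} → (S → Finset (Fin m)) := fun T c =>
    Finset.univ.filter fun t => (t : ℕ) ∈ T.1.entry c
  have hf : Function.Injective f := by
    intro T T' h
    refine Subtype.ext (ext_entry fun c x => ?_)
    by_cases hc : c ∈ S
    · by_cases hx : x < m
      · have := congrArg (fun s => (⟨x, hx⟩ : Fin m) ∈ s) (congrFun h ⟨c, hc⟩)
        simpa [f] using this
      · exact ⟨fun h => absurd (T.2 c x h) hx, fun h => absurd (T'.2 c x h) hx⟩
    · exact ⟨fun h => absurd (T.1.mem_cells h) hc, fun h => absurd (T'.1.mem_cells h) hc⟩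
  exact Finite.of_injective f hf

/-- The set-valued tableaux of shape `S` with entries less than `m`. -/
noncomputable def boundedSVT (S : Finset (ℕ × ℕ)) (m : ℕ) : Finset (SVT S) :=
  (SVT.finite_bounded S m).toFinset

theorem mem_boundedSVT {S : Finset (ℕ × ℕ)} {m : ℕ} {T : SVT S} :
    T ∈ boundedSVT S m ↔ T.Bounded m := by
  simp [boundedSVT]

theorem grothendieck_eq_sum (S : Finset (ℕ × ℕ)) (m : ℕ) :
    grothendieck S m = ∑ T ∈ boundedSVT S m, T.sgn • T.monomial :=
  finsum_mem_eq_finite_toFinset_sum (s := {T : SVT S | T.Bounded m}) _ _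

/-- The determinant with entries `x_k ^ e_j * (1 - x_k) ^ d_j`. -/
noncomputable def powDet {m : ℕ} (e d : Fin m → ℕ) : MvPolynomial ℕ ℤ :=
  (Matrix.of fun k j : Fin m => (X (k : ℕ) : MvPolynomial ℕ ℤ) ^ e j * (1 - X (k : ℕ)) ^ d j).det

/-- The numerator of the bialternant formula for stable Grothendieck polynomials. -/
noncomputable def alternant (m : ℕ) (α : ℕ → ℕ) : MvPolynomial ℕ ℤ :=
  powDet (m := m) (fun j => α j + (m - 1 - j)) (fun j => j)

theorem powDet_comp_perm {m : ℕ} (e d : Fin m → ℕ) (σ : Equiv.Perm (Fin m)) :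
    powDet (e ∘ σ) (d ∘ σ) = Equiv.Perm.sign σ • powDet e d := by
  unfold powDet
  rw [Units.smul_def, zsmul_eq_mul, ← Matrix.det_permute' σ]
  rfl

theorem powDet_sub {m : ℕ} (e d : Fin m → ℕ) (i : Fin m) :
    powDet e d - powDet (Function.update e i (e i + 1)) d =
      powDet e (Function.update d i (d i + 1)) := by
  rw [sub_eq_iff_eq_add]
  unfold powDet
  set M := Matrix.of fun k j : Fin m =>
    (X (k : ℕ) : MvPolynomial ℕ ℤ) ^ e j * (1 - X (k : ℕ)) ^ d j with hM
  have h1 : (Matrix.of fun k j : Fin m => (X (k : ℕ) : MvPolynomial ℕ ℤ) ^ e j *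
      (1 - X (k : ℕ)) ^ Function.update d i (d i + 1) j) =
      M.updateCol i (fun k => (X (k : ℕ)) ^ e i * (1 - X (k : ℕ)) ^ (d i + 1)) := by
    ext1 k j
    rcases eq_or_ne j i with rfl | h
    · simp [hM]
    · simp [hM, h]
  have h2 : (Matrix.of fun k j : Fin m => (X (k : ℕ) : MvPolynomial ℕ ℤ) ^
      Function.update e i (e i + 1) j * (1 - X (k : ℕ)) ^ d j) =
      M.updateCol i (fun k => (X (k : ℕ)) ^ (e i + 1) * (1 - X (k : ℕ)) ^ d i) := by
    ext1 k j
    rcases eq_or_ne j i with rfl | h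
    · simp [hM]
    · simp [hM, h]
  have h3 : M = M.updateCol i ((fun k : Fin m => (X (k : ℕ) : MvPolynomial ℕ ℤ) ^ e i *
      (1 - X (k : ℕ)) ^ (d i + 1)) + fun k : Fin m => (X (k : ℕ) : MvPolynomial ℕ ℤ) ^ (e i + 1) *
        (1 - X (k : ℕ)) ^ d i) := by
    ext1 k j
    rcases eq_or_ne j i with rfl | h
    · simp [hM]; ring
    · simp [hM, h]
  rw [h1, h2, ← Matrix.det_updateCol_add, ← h3]

theorem alternant_congr {m : ℕ} {α β : ℕ → ℕ} (h : ∀ t < m, α t = β t) :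
    alternant m α = alternant m β := by
  unfold alternant
  congr 1
  ext j
  rw [h j j.2]

theorem alternant_sub_swap {m i : ℕ} (hi : i + 1 < m) {α β : ℕ → ℕ} (h1 : β i + 1 = α (i + 1))
    (h2 : β (i + 1) = α i + 1) (h3 : ∀ t, t ≠ i → t ≠ i + 1 → β t = α t) :
    alternant m β - alternant m (Function.update β i (β i + 1)) =
      -(alternant m α - alternant m (Function.update α i (α i + 1))) := by
  let p : Fin m := ⟨i, by omega⟩
  let q : Fin m := ⟨i + 1, hi⟩
  have hpq : p ≠ q := by simp [p, q]
  have key : ∀ γ : ℕ → ℕ, alternant m γ - alternant m (Function.update γ i (γ i + 1)) =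
      powDet (m := m) (fun j => γ j + (m - 1 - j))
        (Function.update (fun j => (j : ℕ)) p (i + 1)) := by
    intro γ
    rw [← powDet_sub (m := m) (fun j => γ j + (m - 1 - j)) (fun j => j) p]
    unfold alternant
    congr 2
    ext j
    rcases eq_or_ne j p with rfl | h
    · simp [p]; omega
    · have : (j : ℕ) ≠ i := fun h' => h (Fin.ext h')
      simp [h, this]
  rw [key, key, ← neg_one_smul ℤ]
  have := powDet_comp_perm (m := m) (fun j => α j + (m - 1 - j))
        (Function.update (fun j => (j : ℕ)) p (i + 1)) (Equiv.swap p q)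
  rw [Equiv.Perm.sign_swap hpq, Units.smul_def] at this
  simp only [Units.val_neg, Units.val_one] at this
  rw [← this]
  congr 1
  · ext j
    rcases eq_or_ne j p with rfl | hp
    · simp [p, q]; omega
    rcases eq_or_ne j q with rfl | hq
    · simp [p, q]; omega
    · have h4 : (j : ℕ) ≠ i := fun h' => hp (Fin.ext h')
      have h5 : (j : ℕ) ≠ i + 1 := fun h' => hq (Fin.ext h')
      simp [Equiv.swap_apply_of_ne_of_ne hp hq, h3 j h4 h5]
  · ext j
    rcases eq_or_ne j p with rfl | hp
    · simp [p, q]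
    rcases eq_or_ne j q with rfl | hq
    · simp [p, q]
    · simp [Equiv.swap_apply_of_ne_of_ne hp hq, hp]

theorem alternant_zero_ne_zero (m : ℕ) : alternant m 0 ≠ 0 := by
  have : alternant m 0 = (Matrix.projVandermonde (R := MvPolynomial ℕ ℤ)
      (fun k : Fin m => 1 - X (k : ℕ)) (fun k => X (k : ℕ))).det := by
    unfold alternant powDet
    congr 1
    ext1 k j
    have h : m - 1 - (j : ℕ) = (j.rev : ℕ) := by rw [Fin.val_rev]; omega
    simp [Matrix.projVandermonde_apply, h, mul_comm]
  rw [this, Matrix.det_projVandermonde]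
  refine Finset.prod_ne_zero_iff.2 fun a _ => Finset.prod_ne_zero_iff.2 fun b hb => ?_
  have hab : a < b := by simpa using hb
  have h : (1 - X (b : ℕ)) * X (a : ℕ) - (1 - X (a : ℕ)) * X (b : ℕ) =
      (X (a : ℕ) - X (b : ℕ) : MvPolynomial ℕ ℤ) := by ring
  rw [h, sub_ne_zero]
  intro h
  exact hab.ne (Fin.ext (X_injective h))

namespace SVT

variable {S : Finset (ℕ × ℕ)}

theorem sgn_bk (hS : (S : Set (ℕ × ℕ)).OrdConnected) {T : SVT S} {i J m : ℕ} (hi : i + 1 < m)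
    (hT : T.Bounded m) (H : T.BKCompat i J) : (T.bk hS i J H).sgn = T.sgn := by
  unfold sgn
  rw [size_eq_sum_wt hT, size_eq_sum_wt (bounded_bk hS H hi hT)]
  congr 2
  let p : Fin m := ⟨i, by omega⟩
  let q : Fin m := ⟨i + 1, hi⟩
  have hpq : q ≠ p := by simp [p, q]
  rw [← Finset.add_sum_erase _ _ (Finset.mem_univ p), ← Finset.add_sum_erase _ _
    (Finset.mem_erase.2 ⟨hpq, Finset.mem_univ q⟩), ← Finset.add_sum_erase Finset.univ
    (fun t : Fin m => T.wt t) (Finset.mem_univ p), ← Finset.add_sum_erase (Finset.univ.erase p)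
    (fun t : Fin m => T.wt t) (Finset.mem_erase.2 ⟨hpq, Finset.mem_univ q⟩)]
  have h : ∑ t ∈ (Finset.univ.erase p).erase q, (T.bk hS i J H).wt t =
      ∑ t ∈ (Finset.univ.erase p).erase q, T.wt t := by
    refine Finset.sum_congr rfl fun t ht => ?_
    simp only [Finset.mem_erase, Finset.mem_univ, and_true] at ht
    exact wt_bk_of_ne hS H (fun h => ht.2 (Fin.ext h)) (fun h => ht.1 (Fin.ext h))
  rw [h]
  simp only [p, q, wt_bk_left, wt_bk_right]
  rw [← wtBelow_add_wtFrom T J i, ← wtBelow_add_wtFrom T J (i + 1)]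
  omega

end SVT

/-- The image of `grothendieck S m` under a permutation of the variables. -/
noncomputable def permGrothendieck (S : Finset (ℕ × ℕ)) (m : ℕ) (σ : Equiv.Perm (Fin m)) :
    MvPolynomial ℕ ℤ :=
  ∑ T ∈ boundedSVT S m, T.sgn • ∏ t : Fin m, (X (σ t : ℕ) : MvPolynomial ℕ ℤ) ^ T.wt t

theorem permGrothendieck_mul_swap {S : Finset (ℕ × ℕ)} (hS : (S : Set (ℕ × ℕ)).OrdConnected)
    {m : ℕ} (σ : Equiv.Perm (Fin m)) {p q : Fin m} (hpq : (p : ℕ) + 1 = q) :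
    permGrothendieck S m (σ * Equiv.swap p q) = permGrothendieck S m σ := by
  obtain ⟨J, hJ⟩ : ∃ J, ∀ c ∈ S, c.2 < J :=
    ⟨S.sup Prod.snd + 1, fun c hc => Nat.lt_succ_of_le (Finset.le_sup (f := Prod.snd) hc)⟩
  have H : ∀ T : SVT S, T.BKCompat p J := fun T r j _ _ y hy =>
    absurd (hJ _ (T.mem_cells hy)) (lt_irrefl _)
  have hF : ∀ (T : SVT S) t, T.wtFrom J t = 0 := fun T t => by
    unfold SVT.wtFrom
    rw [Finset.card_eq_zero, Finset.filter_eq_empty_iff]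
    intro c hc h
    have := hJ c hc
    omega
  have hq : (p : ℕ) + 1 < m := hpq ▸ q.2
  unfold permGrothendieck
  refine Finset.sum_nbij' (fun T => T.bk hS p J (H T)) (fun T => T.bk hS p J (H T)) ?_ ?_ ?_ ?_ ?_
  · exact fun T hT => mem_boundedSVT.2 (SVT.bounded_bk hS _ hq (mem_boundedSVT.1 hT))
  · exact fun T hT => mem_boundedSVT.2 (SVT.bounded_bk hS _ hq (mem_boundedSVT.1 hT))
  · exact fun T _ => SVT.bk_bk hS _
  · exact fun T _ => SVT.bk_bk hS _
  · intro T hT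
    rw [SVT.sgn_bk hS hq (mem_boundedSVT.1 hT)]
    congr 1
    refine Fintype.prod_equiv (Equiv.swap p q) _ _ fun t => ?_
    rw [Equiv.Perm.mul_apply]
    congr 1
    rcases eq_or_ne t p with rfl | hp
    · rw [Equiv.swap_apply_left, ← hpq, SVT.wt_bk_right, hF, ← SVT.wtBelow_add_wtFrom T J, hF]
    rcases eq_or_ne t q with rfl | hq
    · rw [Equiv.swap_apply_right, ← hpq, SVT.wt_bk_left, hF, ← SVT.wtBelow_add_wtFrom T J, hF]
    · rw [Equiv.swap_apply_of_ne_of_ne hp hq, SVT.wt_bk_of_ne]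
      · exact fun h => hp (Fin.ext h)
      · exact fun h => hq (Fin.ext (h.trans hpq))

theorem permGrothendieck_eq {S : Finset (ℕ × ℕ)} (hS : (S : Set (ℕ × ℕ)).OrdConnected)
    {m : ℕ} (σ : Equiv.Perm (Fin m)) : permGrothendieck S m σ = grothendieck S m := by
  have h1 : permGrothendieck S m 1 = grothendieck S m := by
    rw [grothendieck_eq_sum]
    refine Finset.sum_congr rfl fun T hT => ?_
    rw [SVT.monomial_eq_prod_wt (mem_boundedSVT.1 hT)]
    rfl
  rcases m with - | n
  · rw [← h1, Subsingleton.elim σ 1]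
  have hσ : σ ∈ Submonoid.closure
      (Set.range fun i : Fin n => Equiv.swap i.castSucc i.succ) := by
    rw [Equiv.Perm.mclosure_swap_castSucc_succ]
    trivial
  induction hσ using Submonoid.closure_induction_right with
  | one => exact h1
  | mul_right x hx y hy ih =>
    obtain ⟨i, rfl⟩ := hy
    rw [permGrothendieck_mul_swap hS x (by simp), ih]

theorem grothendieck_mul_alternant_zero {S : Finset (ℕ × ℕ)}
    (hS : (S : Set (ℕ × ℕ)).OrdConnected) (m : ℕ) :
    grothendieck S m * alternant m 0 = ∑ T ∈ boundedSVT S m, T.sgn • alternant m T.wt := by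
  simp only [alternant, powDet, Matrix.det_apply, Finset.mul_sum, Finset.smul_sum]
  rw [Finset.sum_comm]
  refine Finset.sum_congr rfl fun σ _ => ?_
  rw [← permGrothendieck_eq hS σ, permGrothendieck, Finset.sum_mul]
  refine Finset.sum_congr rfl fun T _ => ?_
  rw [mul_smul_comm, smul_mul_assoc, smul_comm, ← Finset.prod_mul_distrib]
  congr 2
  refine Finset.prod_congr rfl fun t _ => ?_
  simp [pow_add, mul_assoc]

/-- The reading order of the pairs of a box and a letter: a smaller key is further to the right in
the column word. -/
def readKey (p : (ℕ × ℕ) × ℕ) : ℕᵒᵈ ×ₗ (ℕ ×ₗ ℕᵒᵈ) :=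
  toLex (OrderDual.toDual p.1.2, toLex (p.1.1, OrderDual.toDual p.2))

theorem readKey_lt_iff {p q : (ℕ × ℕ) × ℕ} : readKey p < readKey q ↔
    q.1.2 < p.1.2 ∨ p.1.2 = q.1.2 ∧ (p.1.1 < q.1.1 ∨ p.1.1 = q.1.1 ∧ q.2 < p.2) := by
  simp [readKey, Prod.Lex.lt_iff]

theorem readKey_le_iff {p q : (ℕ × ℕ) × ℕ} : readKey p ≤ readKey q ↔
    q.1.2 < p.1.2 ∨ p.1.2 = q.1.2 ∧ (p.1.1 < q.1.1 ∨ p.1.1 = q.1.1 ∧ q.2 ≤ p.2) := by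
  simp [readKey, Prod.Lex.le_iff]

theorem readKey_injective : Function.Injective readKey := by
  intro p q h
  have h1 := readKey_le_iff.1 h.le
  have h2 := readKey_le_iff.1 h.ge
  exact Prod.ext (Prod.ext (by omega) (by omega)) (by omega)

section

variable {α κ : Type*} [LinearOrder κ] {f : α → κ} {L s : List α} {p : α}

theorem filter_suffix_of_pairwise (h : L.Pairwise fun u v => f v < f u) (k : κ) :
    L.filter (fun u => decide (f u ≤ k)) <:+ L := by
  induction L with
  | nil => simp
  | cons a l ih =>
    rw [List.pairwise_cons] at h
    by_cases ha : f a ≤ k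
    · rw [List.filter_eq_self.2]
      intro b hb
      rcases List.mem_cons.1 hb with rfl | hb
      · simpa
      · simpa using (h.1 b hb).le.trans ha
    · rw [List.filter_cons_of_neg (by simpa using ha)]
      exact (ih h.2).trans (List.suffix_cons a l)

theorem cons_eq_filter_of_suffix (h : L.Pairwise fun u v => f v < f u) (hs : p :: s <:+ L) :
    p :: s = L.filter (fun u => decide (f u ≤ f p)) := by
  obtain ⟨l, rfl⟩ := hs
  rw [List.pairwise_append, List.pairwise_cons] at h
  rw [List.filter_append, List.filter_eq_nil_iff.2, List.filter_eq_self.2]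
  · simp
  · intro b hb
    rcases List.mem_cons.1 hb with rfl | hb
    · simp
    · simpa using (h.2.1.1 b hb).le
  · intro b hb
    simpa using h.2.2 b hb p List.mem_cons_self

end

namespace SVT

variable {S : Finset (ℕ × ℕ)}

/-- The column word of `T`, each letter being recorded together with its box. -/
def readList (T : SVT S) : List ((ℕ × ℕ) × ℕ) :=
  (List.range ((S.sup fun c => max c.1 c.2) + 1)).flatMap fun j =>
    ((List.range ((S.sup fun c => max c.1 c.2) + 1)).reverse).flatMap fun i =>
      ((T.entry (i, j)).sort (· ≤ ·)).map fun x => ((i, j), x)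

theorem map_snd_readList (T : SVT S) : T.readList.map Prod.snd = T.word := by
  simp [readList, word, List.map_flatMap, Function.comp_def]

theorem mem_readList {T : SVT S} {p : (ℕ × ℕ) × ℕ} : p ∈ T.readList ↔ p.2 ∈ T.entry p.1 := by
  obtain ⟨⟨r, j⟩, x⟩ := p
  simp only [readList, List.mem_flatMap, List.mem_range, List.mem_reverse, List.mem_map,
    Finset.mem_sort, Prod.mk.injEq]
  constructor
  · rintro ⟨_, -, _, -, _, h, ⟨rfl, rfl⟩, rfl⟩
    exact h
  · intro h
    have := Finset.le_sup (f := fun c : ℕ × ℕ => max c.1 c.2) (T.mem_cells h)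
    simp only [max_le_iff] at this
    exact ⟨j, by omega, r, by omega, x, h, ⟨rfl, rfl⟩, rfl⟩

theorem pairwise_readList (T : SVT S) :
    T.readList.Pairwise fun u v => readKey v < readKey u := by
  rw [readList, List.pairwise_flatMap]
  refine ⟨fun j _ => ?_, ?_⟩
  · rw [List.pairwise_flatMap]
    refine ⟨fun i _ => ?_, ?_⟩
    · rw [List.pairwise_map]
      refine (T.entry (i, j)).sortedLT_sort.pairwise.imp fun {a b} h => ?_
      simp [readKey_lt_iff, h]
    · rw [List.pairwise_reverse]
      refine List.pairwise_lt_range.imp fun {a b} h u hu v hv => ?_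
      simp only [List.mem_map] at hu hv
      obtain ⟨_, _, rfl⟩ := hu
      obtain ⟨_, _, rfl⟩ := hv
      simp [readKey_lt_iff, h]
  · refine List.pairwise_lt_range.imp fun {a b} h u hu v hv => ?_
    simp only [List.mem_flatMap, List.mem_map] at hu hv
    obtain ⟨_, _, _, _, rfl⟩ := hu
    obtain ⟨_, _, _, _, rfl⟩ := hv
    simp [readKey_lt_iff, h]

/-- The number of letters `t` in the suffix of the column word that ends the reading at
position `q`. -/
def suffixCount (T : SVT S) (q : (ℕ × ℕ) × ℕ) (t : ℕ) : ℕ :=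
  (S.filter fun c => t ∈ T.entry c ∧ readKey (c, t) ≤ readKey q).card

theorem count_map_filter_readList (T : SVT S) (P : (ℕ × ℕ) × ℕ → Prop) [DecidablePred P] (t : ℕ) :
    ((T.readList.filter fun u => decide (P u)).map Prod.snd).count t =
      (S.filter fun c => t ∈ T.entry c ∧ P (c, t)).card := by
  rw [List.count, List.countP_map, List.countP_eq_length_filter, List.filter_filter]
  have hnd : T.readList.Nodup :=
    T.pairwise_readList.imp fun {a b} h hab => by simp [hab] at h
  rw [← List.toFinset_card_of_nodup (hnd.filter _)]
  refine Finset.card_nbij' Prod.fst (fun c => (c, t)) ?_ ?_ ?_ ?_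
  · rintro ⟨c, x⟩ h
    simp only [Finset.mem_coe, List.mem_toFinset, List.mem_filter, mem_readList, Function.comp_apply,
      Bool.and_eq_true, beq_iff_eq, decide_eq_true_eq] at h
    obtain ⟨h1, rfl, h2⟩ := h
    simpa using ⟨T.mem_cells h1, h1, h2⟩
  · intro c h
    simp only [Finset.mem_coe, Finset.mem_filter] at h
    simp [mem_readList, h]
  · rintro ⟨c, x⟩ h
    simp only [Finset.mem_coe, List.mem_toFinset, List.mem_filter, Function.comp_apply,
      Bool.and_eq_true, beq_iff_eq] at h
    simp [h.2.1]
  · intro c _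
    rfl

theorem count_word (T : SVT S) (t : ℕ) : T.word.count t = T.wt t := by
  have := T.count_map_filter_readList (fun _ => True) t
  simpa [map_snd_readList, wt] using this

theorem isRLW_word_iff (T : SVT S) :
    IsRLW T.word ↔ ∀ q i, T.suffixCount q (i + 1) ≤ T.suffixCount q i := by
  rw [← map_snd_readList]
  constructor
  · intro h q i
    have := h _ ((filter_suffix_of_pairwise T.pairwise_readList (readKey q)).map Prod.snd) i
    rwa [count_map_filter_readList, count_map_filter_readList] at this
  · intro h s hs i
    obtain ⟨u, hu, rfl⟩ := List.suffix_map_iff.1 hs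
    rcases u with - | ⟨p, u⟩
    · simp
    · rw [cons_eq_filter_of_suffix T.pairwise_readList hu, count_map_filter_readList,
        count_map_filter_readList]
      exact h p i

end SVT

namespace SVT

variable {S : Finset (ℕ × ℕ)} {T : SVT S} {c : ℕ × ℕ} {i : ℕ}

theorem suffixCount_congr {T T' : SVT S} {k : (ℕ × ℕ) × ℕ}
    (h : ∀ c t, readKey (c, t) ≤ readKey k → (t ∈ T.entry c ↔ t ∈ T'.entry c))
    {q : (ℕ × ℕ) × ℕ} (hq : readKey q ≤ readKey k) (t : ℕ) :
    T.suffixCount q t = T'.suffixCount q t := by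
  unfold suffixCount
  congr 1
  refine Finset.filter_congr fun c _ => and_congr_left fun hc => h c t (hc.trans hq)

/-- Reading the letter `i + 1` in the box `c` is the first violation of the lattice condition. -/
structure FirstBad (T : SVT S) (c : ℕ × ℕ) (i : ℕ) : Prop where
  mem : i + 1 ∈ T.entry c
  lt : T.suffixCount (c, i + 1) i < T.suffixCount (c, i + 1) (i + 1)
  le : ∀ q, readKey q < readKey (c, i + 1) → ∀ t, T.suffixCount q (t + 1) ≤ T.suffixCount q t

theorem FirstBad.unique {c' : ℕ × ℕ} {i' : ℕ} (h : T.FirstBad c i) (h' : T.FirstBad c' i') :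
    c = c' ∧ i = i' := by
  rcases lt_trichotomy (readKey (c, i + 1)) (readKey (c', i' + 1)) with hlt | heq | hlt
  · exact absurd h.lt (h'.le _ hlt i).not_gt
  · have := readKey_injective heq
    simpa using this
  · exact absurd h'.lt (h.le _ hlt i').not_gt

theorem FirstBad.congr {T T' : SVT S} (hT : T.FirstBad c i)
    (h : ∀ c' t, readKey (c', t) ≤ readKey (c, i + 1) → (t ∈ T.entry c' ↔ t ∈ T'.entry c')) :
    T'.FirstBad c i where
  mem := (h c (i + 1) le_rfl).1 hT.mem
  lt := by
    rw [← suffixCount_congr h le_rfl, ← suffixCount_congr h le_rfl]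
    exact hT.lt
  le q hq t := by
    rw [← suffixCount_congr h hq.le, ← suffixCount_congr h hq.le]
    exact hT.le q hq t

theorem FirstBad.not_isRLW (h : T.FirstBad c i) : ¬ IsRLW T.word := fun hw =>
  absurd h.lt ((T.isRLW_word_iff.1 hw _ _).not_gt)

theorem exists_firstBad (h : ¬ IsRLW T.word) : ∃ c i, T.FirstBad c i := by
  rw [isRLW_word_iff] at h
  let R : (ℕ × ℕ) × ℕ → Finset ((ℕ × ℕ) × ℕ) := fun q =>
    T.readList.toFinset.filter fun u => readKey u ≤ readKey q
  have hR : ∀ q u, u ∈ R q ↔ u.2 ∈ T.entry u.1 ∧ readKey u ≤ readKey q := by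
    simp [R, mem_readList]
  let Bad : (ℕ × ℕ) × ℕ → Prop := fun q => ∃ i, T.suffixCount q i < T.suffixCount q (i + 1)
  have hex : ∃ n q, Bad q ∧ (R q).card = n := by
    push Not at h
    obtain ⟨q, i, hq⟩ := h
    exact ⟨_, q, ⟨i, hq⟩, rfl⟩
  classical
  obtain ⟨q, ⟨i, hq⟩, hqn⟩ := Nat.find_spec hex
  have hmin : ∀ q', Bad q' → (R q).card ≤ (R q').card := fun q' h' =>
    hqn ▸ Nat.find_min' hex ⟨q', h', rfl⟩
  have hne : (R q).Nonempty := by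
    obtain ⟨c, hc⟩ := Finset.card_pos.1 (lt_of_le_of_lt (Nat.zero_le _) hq)
    simp only [Finset.mem_filter] at hc
    exact ⟨(c, i + 1), (hR _ _).2 hc.2⟩
  obtain ⟨p, hp, hpmax⟩ := Finset.exists_max_image (R q) readKey hne
  have hpq := (hR _ _).1 hp
  have hcount : ∀ t, T.suffixCount p t = T.suffixCount q t := by
    intro t
    unfold suffixCount
    congr 1
    refine Finset.filter_congr fun c _ => and_congr_right fun hc =>
      ⟨fun h => h.trans hpq.2, fun h => hpmax (c, t) ((hR _ _).2 ⟨hc, h⟩)⟩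
  have hbefore : ∀ q', readKey q' < readKey p → ∀ t, T.suffixCount q' (t + 1) ≤
      T.suffixCount q' t := by
    intro q' hq' t
    by_contra hbad
    refine absurd (hmin q' ⟨t, not_le.1 hbad⟩) (not_le.2 (Finset.card_lt_card ?_))
    refine Finset.ssubset_iff_of_subset (fun u hu => ?_) |>.2 ⟨p, hp, fun hp' => ?_⟩
    · rw [hR] at hu ⊢
      exact ⟨hu.1, hu.2.trans (hq'.le.trans hpq.2)⟩
    · exact absurd ((hR _ _).1 hp').2 (not_le.2 hq')
  obtain ⟨c, x⟩ := p
  have hx : x = i + 1 := by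
    by_contra hx
    have h1 := hbefore (c, x + 1) (by simp [readKey_lt_iff]) i
    have h2 : T.suffixCount (c, x) (i + 1) ≤ T.suffixCount (c, x + 1) (i + 1) := by
      refine Finset.card_le_card fun c' hc' => ?_
      simp only [Finset.mem_filter, readKey_le_iff] at hc' ⊢
      refine ⟨hc'.1, hc'.2.1, ?_⟩
      omega
    have h3 : T.suffixCount (c, x + 1) i ≤ T.suffixCount (c, x) i := by
      refine Finset.card_le_card fun c' hc' => ?_
      simp only [Finset.mem_filter, readKey_le_iff] at hc' ⊢
      refine ⟨hc'.1, hc'.2.1, ?_⟩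
      omega
    have h4 := hcount i
    have h5 := hcount (i + 1)
    omega
  subst hx
  exact ⟨c, i, hpq.1, by rw [hcount, hcount]; exact hq, hbefore⟩

end SVT

namespace SVT

variable {S : Finset (ℕ × ℕ)}

/-- Add the letter `i` to the box `Q`. -/
def ins (T : SVT S) (Q : ℕ × ℕ) (i : ℕ) (hQ : Q ∈ S)
    (hl : ∀ j, j + 1 = Q.2 → ∀ x ∈ T.entry (Q.1, j), x ≤ i)
    (hr : ∀ y ∈ T.entry (Q.1, Q.2 + 1), i ≤ y)
    (hu : ∀ r, r + 1 = Q.1 → ∀ x ∈ T.entry (r, Q.2), x < i)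
    (hd : ∀ y ∈ T.entry (Q.1 + 1, Q.2), i < y) : SVT S where
  entry := Function.update T.entry Q (insert i (T.entry Q))
  nonempty_of_mem c hc := by
    by_cases h : c = Q
    · subst h; simp
    · simpa [h] using T.nonempty_of_mem c hc
  eq_empty_of_not_mem c hc := by
    rw [Function.update_of_ne (by rintro rfl; exact hc hQ), T.eq_empty_of_not_mem c hc]
  row_weak r j h1 h2 x hx y hy := by
    by_cases e1 : (r, j) = Q
    · subst e1
      have hne : (r, j + 1) ≠ (r, j) := by simp
      rw [Function.update_self] at hx
      rw [Function.update_of_ne hne] at hy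
      rcases Finset.mem_insert.1 hx with rfl | hx
      · exact hr y hy
      · exact T.row_weak r j h1 h2 x hx y hy
    · rw [Function.update_of_ne e1] at hx
      by_cases e2 : (r, j + 1) = Q
      · subst e2
        rw [Function.update_self] at hy
        rcases Finset.mem_insert.1 hy with rfl | hy
        · exact hl j rfl x hx
        · exact T.row_weak r j h1 h2 x hx y hy
      · rw [Function.update_of_ne e2] at hy
        exact T.row_weak r j h1 h2 x hx y hy
  col_strict r j h1 h2 x hx y hy := by
    by_cases e1 : (r, j) = Q
    · subst e1
      have hne : (r + 1, j) ≠ (r, j) := by simp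
      rw [Function.update_self] at hx
      rw [Function.update_of_ne hne] at hy
      rcases Finset.mem_insert.1 hx with rfl | hx
      · exact hd y hy
      · exact T.col_strict r j h1 h2 x hx y hy
    · rw [Function.update_of_ne e1] at hx
      by_cases e2 : (r + 1, j) = Q
      · subst e2
        rw [Function.update_self] at hy
        rcases Finset.mem_insert.1 hy with rfl | hy
        · exact hu r rfl x hx
        · exact T.col_strict r j h1 h2 x hx y hy
      · rw [Function.update_of_ne e2] at hy
        exact T.col_strict r j h1 h2 x hx y hy

/-- Remove the letter `i` from the box `Q`. -/
def del (T : SVT S) (Q : ℕ × ℕ) (i : ℕ) (h : ((T.entry Q).erase i).Nonempty) : SVT S where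
  entry := Function.update T.entry Q ((T.entry Q).erase i)
  nonempty_of_mem c hc := by
    by_cases h : c = Q
    · subst h; simpa
    · simpa [h] using T.nonempty_of_mem c hc
  eq_empty_of_not_mem c hc := by
    have hcQ : c ≠ Q := by
      rintro rfl
      obtain ⟨x, hx⟩ := h
      exact hc (T.mem_cells (Finset.mem_of_mem_erase hx))
    rw [Function.update_of_ne hcQ, T.eq_empty_of_not_mem c hc]
  row_weak r j h1 h2 x hx y hy := by
    have hsub : ∀ c, Function.update T.entry Q ((T.entry Q).erase i) c ⊆ T.entry c := by
      intro c
      by_cases hc : c = Q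
      · subst hc; simpa using Finset.erase_subset _ _
      · simp [hc]
    exact T.row_weak r j h1 h2 x (hsub _ hx) y (hsub _ hy)
  col_strict r j h1 h2 x hx y hy := by
    have hsub : ∀ c, Function.update T.entry Q ((T.entry Q).erase i) c ⊆ T.entry c := by
      intro c
      by_cases hc : c = Q
      · subst hc; simpa using Finset.erase_subset _ _
      · simp [hc]
    exact T.col_strict r j h1 h2 x (hsub _ hx) y (hsub _ hy)

theorem mem_ins {T : SVT S} {Q : ℕ × ℕ} {i : ℕ} {hQ hl hr hu hd} {c : ℕ × ℕ} {x : ℕ} :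
    x ∈ (T.ins Q i hQ hl hr hu hd).entry c ↔ (c = Q ∧ x = i) ∨ x ∈ T.entry c := by
  change x ∈ Function.update T.entry Q (insert i (T.entry Q)) c ↔ _
  by_cases hc : c = Q
  · subst hc; simp
  · simp [hc]

theorem mem_del {T : SVT S} {Q : ℕ × ℕ} {i : ℕ} {h} {c : ℕ × ℕ} {x : ℕ} :
    x ∈ (T.del Q i h).entry c ↔ ¬ (c = Q ∧ x = i) ∧ x ∈ T.entry c := by
  change x ∈ Function.update T.entry Q ((T.entry Q).erase i) c ↔ _
  by_cases hc : c = Q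
  · subst hc; simp
  · simp [hc]

/-- `T'` arises from `T` by adding the new letter `i` to the box `Q`. -/
structure IsIns (T T' : SVT S) (Q : ℕ × ℕ) (i : ℕ) : Prop where
  cell : Q ∈ S
  notMem : i ∉ T.entry Q
  mem_iff : ∀ c x, x ∈ T'.entry c ↔ (c = Q ∧ x = i) ∨ x ∈ T.entry c

theorem IsIns.wt {T T' : SVT S} {Q : ℕ × ℕ} {i : ℕ} (h : IsIns T T' Q i) :
    T'.wt = Function.update T.wt i (T.wt i + 1) := by
  funext t
  unfold SVT.wt
  by_cases ht : t = i
  · subst ht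
    rw [Function.update_self, ← Finset.card_insert_of_notMem (a := Q) (by simp [h.notMem])]
    congr 1
    ext c
    simp only [Finset.mem_filter, Finset.mem_insert, h.mem_iff]
    have := h.cell
    constructor
    · tauto
    · rintro (rfl | h) <;> tauto
  · rw [Function.update_of_ne ht]
    congr 1
    refine Finset.filter_congr fun c _ => ?_
    simp [h.mem_iff, ht]

theorem IsIns.sgn {T T' : SVT S} {Q : ℕ × ℕ} {i : ℕ} (h : IsIns T T' Q i) :
    T'.sgn = -T.sgn := by
  have h1 : T'.entry Q = insert i (T.entry Q) := by ext x; simp [h.mem_iff]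
  have h2 : T'.size = T.size + 1 := by
    unfold size
    rw [← Finset.add_sum_erase _ _ h.cell, ← Finset.add_sum_erase (a := Q) S _ h.cell, h1,
      Finset.card_insert_of_notMem h.notMem]
    have : ∑ c ∈ S.erase Q, (T'.entry c).card = ∑ c ∈ S.erase Q, (T.entry c).card := by
      refine Finset.sum_congr rfl fun c hc => ?_
      congr 1
      ext x
      simp [h.mem_iff, (Finset.mem_erase.1 hc).1]
    omega
  have h3 := T.card_le_size
  unfold SVT.sgn
  rw [h2, Nat.succ_sub h3, pow_succ]
  ring

theorem IsIns.eq_right {T T' T'' : SVT S} {Q : ℕ × ℕ} {i : ℕ} (h : IsIns T T' Q i)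
    (h' : IsIns T T'' Q i) : T' = T'' :=
  ext_entry fun c x => by rw [h.mem_iff, h'.mem_iff]

theorem IsIns.eq_left {T T' T'' : SVT S} {Q : ℕ × ℕ} {i : ℕ} (h : IsIns T T'' Q i)
    (h' : IsIns T' T'' Q i) : T = T' :=
  ext_entry fun c x => by
    have h1 := h.mem_iff c x
    have h2 := h'.mem_iff c x
    have h3 := h.notMem
    have h4 := h'.notMem
    by_cases hc : c = Q ∧ x = i
    · rcases hc with ⟨rfl, rfl⟩; tauto
    · tauto

/-- The leftmost column in which row `r` contains `t`. -/
noncomputable def leadCol (T : SVT S) (r t : ℕ) : ℕ := sInf {j | t ∈ T.entry (r, j)}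

theorem IsIns.leadCol {T T' : SVT S} {Q : ℕ × ℕ} {i : ℕ} (h : IsIns T T' Q i) (r : ℕ) :
    T'.leadCol r (i + 1) = T.leadCol r (i + 1) := by
  unfold SVT.leadCol
  congr 1
  ext j
  simp [h.mem_iff]

variable {T : SVT S} {r₀ j₀ i : ℕ}

theorem FirstBad.notMem_above (hS : (S : Set (ℕ × ℕ)).OrdConnected) (h : T.FirstBad (r₀, j₀) i)
    {r : ℕ} (hr : r < r₀) : i ∉ T.entry (r, j₀) := by
  intro hi
  have hr1 : r + 1 = r₀ := by
    by_contra hne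
    have hc : (r + 1, j₀) ∈ S := hS.out (T.mem_cells hi) (T.mem_cells h.mem)
      ⟨⟨by simp, le_rfl⟩, ⟨by simp; omega, le_rfl⟩⟩
    obtain ⟨z, hz⟩ := T.nonempty_of_mem _ hc
    have h1 := T.col_lt hS (Nat.lt_succ_self r) hi hz
    have h2 := T.col_lt hS (show r + 1 < r₀ by omega) hz h.mem
    omega
  have h1 := h.le ((r, j₀), i + 1) (by simp [readKey_lt_iff, hr]) i
  have h2 : T.suffixCount ((r₀, j₀), i + 1) (i + 1) ≤
      T.suffixCount ((r, j₀), i + 1) (i + 1) + 1 := by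
    refine (Finset.card_le_card (t := insert (r₀, j₀) _) ?_).trans (Finset.card_insert_le _ _)
    rintro ⟨a, b⟩ hc
    simp only [Finset.mem_filter, Finset.mem_insert, readKey_le_iff, Prod.mk.injEq] at hc ⊢
    refine or_iff_not_imp_left.2 fun hne => ⟨hc.1, hc.2.1, ?_⟩
    omega
  have h3 : T.suffixCount ((r, j₀), i + 1) i + 1 ≤ T.suffixCount ((r₀, j₀), i + 1) i := by
    unfold suffixCount
    rw [← Finset.card_insert_of_notMem (a := (r, j₀)) (by simp [readKey_le_iff])]
    refine Finset.card_le_card ?_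
    rintro ⟨a, b⟩ hc
    simp only [Finset.mem_filter, Finset.mem_insert, readKey_le_iff, Prod.mk.injEq] at hc ⊢
    rcases hc with ⟨rfl, rfl⟩ | hc
    · exact ⟨T.mem_cells hi, hi, by omega⟩
    · exact ⟨hc.1, hc.2.1, by omega⟩
  have := h.lt
  omega

theorem FirstBad.leadCol_mem (h : T.FirstBad (r₀, j₀) i) :
    i + 1 ∈ T.entry (r₀, T.leadCol r₀ (i + 1)) :=
  Nat.sInf_mem (s := {j | i + 1 ∈ T.entry (r₀, j)}) ⟨j₀, h.mem⟩

theorem leadCol_le {j : ℕ} (h : i ∈ T.entry (r₀, j)) : T.leadCol r₀ i ≤ j :=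
  Nat.sInf_le (s := {j | i ∈ T.entry (r₀, j)}) h

theorem FirstBad.exists_isIns (hS : (S : Set (ℕ × ℕ)).OrdConnected) (h : T.FirstBad (r₀, j₀) i)
    (hi : i ∉ T.entry (r₀, T.leadCol r₀ (i + 1))) :
    ∃ T', IsIns T T' (r₀, T.leadCol r₀ (i + 1)) i := by
  have hm := h.leadCol_mem
  have hle : T.leadCol r₀ (i + 1) ≤ j₀ := leadCol_le h.mem
  set J := T.leadCol r₀ (i + 1) with hJ
  refine ⟨T.ins (r₀, J) i (T.mem_cells hm) ?_ ?_ ?_ ?_, T.mem_cells hm, hi, fun c x => mem_ins⟩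
  · intro j hj x hx
    have h1 := T.row_le hS (show j < J by simp at hj; omega) hx hm
    rcases h1.eq_or_lt with rfl | h1
    · have : J ≤ j := leadCol_le hx
      simp at hj
      omega
    · omega
  · intro y hy
    have := T.row_le hS (Nat.lt_succ_self J) hm hy
    omega
  · rintro r rfl x hx
    have h1 := T.col_lt hS (Nat.lt_succ_self r) hx hm
    rcases (Nat.le_of_lt_succ h1).eq_or_lt with rfl | h1
    · exfalso
      have hc : (r, j₀) ∈ S := hS.out (T.mem_cells hx) (T.mem_cells h.mem)
        ⟨⟨le_rfl, hle⟩, ⟨by simp, le_rfl⟩⟩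
      obtain ⟨z, hz⟩ := T.nonempty_of_mem _ hc
      have h3 := T.col_lt hS (Nat.lt_succ_self r) hz h.mem
      have h4 : x ≤ z := by
        rcases hle.eq_or_lt with h5 | h5
        · by_contra hlt
          exact h.notMem_above hS (Nat.lt_succ_self r) (h5 ▸ hx)
        · exact T.row_le hS h5 hx hz
      exact h.notMem_above hS (Nat.lt_succ_self r) ((show z = x by omega) ▸ hz)
    · exact h1
  · intro y hy
    have := T.col_lt hS (Nat.lt_succ_self r₀) hm hy
    omega

theorem FirstBad.exists_isIns_left (h : T.FirstBad (r₀, j₀) i)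
    (hi : i ∈ T.entry (r₀, T.leadCol r₀ (i + 1))) :
    ∃ T', IsIns T' T (r₀, T.leadCol r₀ (i + 1)) i := by
  have hne : ((T.entry (r₀, T.leadCol r₀ (i + 1))).erase i).Nonempty :=
    ⟨i + 1, by simpa using h.leadCol_mem⟩
  refine ⟨T.del _ i hne, T.mem_cells hi, ?_, fun c x => ?_⟩
  · simp [mem_del]
  · rw [mem_del]
    by_cases hc : c = (r₀, T.leadCol r₀ (i + 1)) ∧ x = i
    · rcases hc with ⟨rfl, rfl⟩; simpa
    · simp only [hc, not_false_eq_true, true_and, false_or]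

theorem IsIns.firstBad_iff {T' : SVT S} {J : ℕ} (hins : IsIns T T' (r₀, J) i) (hJ : J ≤ j₀) :
    T.FirstBad (r₀, j₀) i ↔ T'.FirstBad (r₀, j₀) i := by
  have key : ∀ c' t, readKey (c', t) ≤ readKey ((r₀, j₀), i + 1) →
      (t ∈ T.entry c' ↔ t ∈ T'.entry c') := by
    intro c t hk
    rw [hins.mem_iff]
    have : ¬ (c = (r₀, J) ∧ t = i) := by
      rintro ⟨rfl, rfl⟩
      simp only [readKey_le_iff] at hk
      omega
    tauto
  exact ⟨fun h => h.congr key, fun h => h.congr fun c t hk => (key c t hk).symm⟩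

theorem IsIns.bounded_iff {T' : SVT S} {Q : ℕ × ℕ} {m : ℕ} (hins : IsIns T T' Q i) (hi : i < m) :
    T.Bounded m ↔ T'.Bounded m := by
  constructor
  · intro h c x hx
    rcases (hins.mem_iff c x).1 hx with ⟨-, rfl⟩ | hx
    · exact hi
    · exact h c x hx
  · exact fun h c x hx => h c x ((hins.mem_iff c x).2 (Or.inr hx))

end SVT

namespace SVT

variable {S : Finset (ℕ × ℕ)} {T : SVT S} {r₀ j₀ i m : ℕ}

theorem FirstBad.notMem_leadCol_iff (hS : (S : Set (ℕ × ℕ)).OrdConnected)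
    (h : T.FirstBad (r₀, j₀) i) : i ∉ T.entry (r₀, T.leadCol r₀ (i + 1)) ↔
      ∀ j ≤ j₀, i + 1 ∈ T.entry (r₀, j) → i ∉ T.entry (r₀, j) := by
  constructor
  · intro hi j _ h1 h2
    rcases (leadCol_le h1).eq_or_lt with h3 | h3
    · exact hi (h3 ▸ h2)
    · have := T.row_le hS h3 h.leadCol_mem h2
      omega
  · exact fun hi => hi _ (leadCol_le h.mem) h.leadCol_mem

theorem FirstBad.bkCompat (hS : (S : Set (ℕ × ℕ)).OrdConnected) (h : T.FirstBad (r₀, j₀) i)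
    (hi : i ∉ T.entry (r₀, T.leadCol r₀ (i + 1))) : T.BKCompat i j₀ := by
  rw [h.notMem_leadCol_iff hS] at hi
  intro r j hj hf y hy
  have h1 : i ≤ y := hf.1.elim (T.row_le hS hj · hy)
    (fun h => (Nat.le_succ i).trans (T.row_le hS hj h hy))
  rcases h1.eq_or_lt with rfl | h1
  · exfalso
    rcases lt_trichotomy r r₀ with hr | rfl | hr
    · exact h.notMem_above hS hr hy
    · exact hi j₀ le_rfl h.mem hy
    · have := T.col_lt hS hr h.mem hy
      omega
  · exact h1

theorem FirstBad.bk (hS : (S : Set (ℕ × ℕ)).OrdConnected) (h : T.FirstBad (r₀, j₀) i)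
    (H : T.BKCompat i j₀) : (T.bk hS i j₀ H).FirstBad (r₀, j₀) i := by
  refine h.congr fun c t hk => ?_
  rw [bk_entry_of_le hS H]
  simp only [readKey_le_iff] at hk
  omega

theorem FirstBad.bk_notMem_leadCol (hS : (S : Set (ℕ × ℕ)).OrdConnected)
    (h : T.FirstBad (r₀, j₀) i) (H : T.BKCompat i j₀)
    (hi : i ∉ T.entry (r₀, T.leadCol r₀ (i + 1))) :
    i ∉ (T.bk hS i j₀ H).entry (r₀, (T.bk hS i j₀ H).leadCol r₀ (i + 1)) := by
  rw [(h.bk hS H).notMem_leadCol_iff hS]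
  rw [h.notMem_leadCol_iff hS] at hi
  intro j hj h1 h2
  by_cases hc : (r₀, j).2 < j₀ ∧ T.IsFree i (r₀, j)
  · rw [mem_bk_of_free hS H hc.1 hc.2] at h1 h2
    have h3 : i ∈ T.entry (r₀, flipIn (T.freeCols i j₀ r₀) j) := by simpa using h1
    have h4 : i + 1 ∈ T.entry (r₀, flipIn (T.freeCols i j₀ r₀) j) := by simpa using h2
    exact hi _ (isFree_flip hS hc.1 hc.2).1.le h4 h3
  · rw [mem_bk_of_not hS H hc] at h1 h2
    exact hi j hj h1 h2

theorem FirstBad.wtFrom_succ (hS : (S : Set (ℕ × ℕ)).OrdConnected) (h : T.FirstBad (r₀, j₀) i)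
    (hi : i ∉ T.entry (r₀, T.leadCol r₀ (i + 1))) :
    T.wtFrom j₀ (i + 1) = T.wtFrom j₀ i + 1 := by
  rw [h.notMem_leadCol_iff hS] at hi
  have h1 : T.suffixCount ((r₀, j₀), i + 1) (i + 1) = T.wtFrom j₀ (i + 1) := by
    unfold suffixCount wtFrom
    congr 1
    refine Finset.filter_congr ?_
    rintro ⟨a, b⟩ -
    refine and_congr_right fun hc => ?_
    simp only [readKey_le_iff]
    constructor
    · omega
    · intro hb
      rcases hb.eq_or_lt with rfl | hb
      · rcases lt_or_ge r₀ a with ha | ha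
        · have := T.col_lt hS ha h.mem hc
          omega
        · omega
      · omega
  have h2 : T.suffixCount ((r₀, j₀), i + 1) i = T.wtFrom j₀ i := by
    unfold suffixCount wtFrom
    congr 1
    refine Finset.filter_congr ?_
    rintro ⟨a, b⟩ -
    refine and_congr_right fun hc => ?_
    simp only [readKey_le_iff]
    constructor
    · omega
    · intro hb
      rcases hb.eq_or_lt with rfl | hb
      · rcases lt_trichotomy r₀ a with ha | rfl | ha
        · have := T.col_lt hS ha h.mem hc
          omega
        · exact absurd hc (hi _ le_rfl h.mem)
        · omega
      · omega
  have h3 : T.suffixCount ((r₀, j₀), i + 1) (i + 1) ≤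
      T.suffixCount ((r₀, j₀), i + 2) (i + 1) + 1 := by
    refine (Finset.card_le_card (t := insert (r₀, j₀) _) ?_).trans (Finset.card_insert_le _ _)
    rintro ⟨a, b⟩ hc
    simp only [Finset.mem_filter, Finset.mem_insert, readKey_le_iff, Prod.mk.injEq] at hc ⊢
    refine or_iff_not_imp_left.2 fun hne => ⟨hc.1, hc.2.1, ?_⟩
    omega
  have h4 : T.suffixCount ((r₀, j₀), i + 2) i ≤ T.suffixCount ((r₀, j₀), i + 1) i := by
    refine Finset.card_le_card ?_
    rintro ⟨a, b⟩ hc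
    simp only [Finset.mem_filter, readKey_le_iff] at hc ⊢
    exact ⟨hc.1, hc.2.1, by omega⟩
  have h5 := h.le ((r₀, j₀), i + 2) (by simp [readKey_lt_iff]) i
  have h6 := h.lt
  omega

open scoped Classical in
theorem sum_firstBad_eq_zero (hS : (S : Set (ℕ × ℕ)).OrdConnected) (m : ℕ) (c₀ : ℕ × ℕ) (i : ℕ) :
    ∑ T ∈ (boundedSVT S m).filter (fun T => T.FirstBad c₀ i), T.sgn • alternant m T.wt = 0 := by
  obtain ⟨r₀, j₀⟩ := c₀
  let P : SVT S → Prop := fun T => i ∈ T.entry (r₀, T.leadCol r₀ (i + 1))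
  set K := (boundedSVT S m).filter fun T => T.FirstBad (r₀, j₀) i with hK
  have hmem : ∀ T, T ∈ K ↔ T.Bounded m ∧ T.FirstBad (r₀, j₀) i := by
    simp [hK, mem_boundedSVT]
  have hmem0 : ∀ T, T ∈ K.filter (fun T => ¬ P T) ↔
      T.Bounded m ∧ T.FirstBad (r₀, j₀) i ∧ ¬ P T := by
    intro T; rw [Finset.mem_filter, hmem, and_assoc]
  rw [← Finset.sum_filter_add_sum_filter_not K P]
  let g : SVT S → MvPolynomial ℕ ℤ := fun T =>
    T.sgn • (alternant m T.wt - alternant m (Function.update T.wt i (T.wt i + 1)))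
  have hone : ∑ T ∈ K.filter P, T.sgn • alternant m T.wt =
      ∑ T ∈ K.filter (fun T => ¬ P T),
        -(T.sgn • alternant m (Function.update T.wt i (T.wt i + 1))) := by
    symm
    refine Finset.sum_bij
      (fun T hT => (((hmem0 T).1 hT).2.1.exists_isIns hS ((hmem0 T).1 hT).2.2).choose) ?_ ?_ ?_ ?_
    · intro T hT
      have hT' := (hmem0 T).1 hT
      have hins := (hT'.2.1.exists_isIns hS hT'.2.2).choose_spec
      set T' := (hT'.2.1.exists_isIns hS hT'.2.2).choose
      have hi : i < m := by have := hT'.1 _ _ hT'.2.1.mem; omega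
      rw [Finset.mem_filter, hmem, ← hins.bounded_iff hi,
        ← hins.firstBad_iff (leadCol_le hT'.2.1.mem)]
      refine ⟨⟨hT'.1, hT'.2.1⟩, ?_⟩
      simp only [P]
      rw [hins.leadCol, hins.mem_iff]
      simp
    · intro T₁ h₁ T₂ h₂ heq
      have h₁' := (hmem0 _).1 h₁
      have h₂' := (hmem0 _).1 h₂
      have hins₁ := (h₁'.2.1.exists_isIns hS h₁'.2.2).choose_spec
      have hins₂ := (h₂'.2.1.exists_isIns hS h₂'.2.2).choose_spec
      rw [heq] at hins₁
      have hlead := hins₁.leadCol r₀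
      rw [hins₂.leadCol r₀] at hlead
      rw [← hlead] at hins₁
      exact hins₁.eq_left hins₂
    · intro T hT
      obtain ⟨hT, hP⟩ := Finset.mem_filter.1 hT
      rw [hmem] at hT
      obtain ⟨T', hins⟩ := hT.2.exists_isIns_left hP
      have hi : i < m := hT.1 _ _ hP
      have hlead := hins.leadCol r₀
      have hT' : T' ∈ K.filter (fun T => ¬ P T) := by
        rw [hmem0, hins.bounded_iff hi, hins.firstBad_iff (leadCol_le hT.2.mem)]
        refine ⟨hT.1, hT.2, ?_⟩
        simp only [P]
        rw [← hlead]
        exact hins.notMem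
      refine ⟨T', hT', ?_⟩
      have hT'' := (hmem0 _).1 hT'
      have hins' := (hT''.2.1.exists_isIns hS hT''.2.2).choose_spec
      exact hins'.eq_right (hlead ▸ hins)
    · intro T hT
      have hT' := (hmem0 T).1 hT
      have hins := (hT'.2.1.exists_isIns hS hT'.2.2).choose_spec
      rw [hins.sgn, hins.wt, neg_smul]
  have htwo : ∑ T ∈ K.filter (fun T => ¬ P T), g T = ∑ T ∈ K.filter (fun T => ¬ P T), -g T := by
    refine Finset.sum_bij'
      (fun T hT => T.bk hS i j₀ (((hmem0 T).1 hT).2.1.bkCompat hS ((hmem0 T).1 hT).2.2))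
      (fun T hT => T.bk hS i j₀ (((hmem0 T).1 hT).2.1.bkCompat hS ((hmem0 T).1 hT).2.2))
      ?_ ?_ ?_ ?_ ?_
    iterate 2
      intro T hT
      have hT' := (hmem0 T).1 hT
      have hi : i + 1 < m := hT'.1 _ _ hT'.2.1.mem
      have H := hT'.2.1.bkCompat hS hT'.2.2
      exact (hmem0 _).2 ⟨bounded_bk hS H hi hT'.1, hT'.2.1.bk hS H,
        hT'.2.1.bk_notMem_leadCol hS H hT'.2.2⟩
    iterate 2
      exact fun T hT => bk_bk hS _
    intro T hT
    have hT' := (hmem0 T).1 hT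
    have hi : i + 1 < m := hT'.1 _ _ hT'.2.1.mem
    have H := hT'.2.1.bkCompat hS hT'.2.2
    have hw := hT'.2.1.wtFrom_succ hS hT'.2.2
    have h1 := T.wtBelow_add_wtFrom j₀ i
    have h2 := T.wtBelow_add_wtFrom j₀ (i + 1)
    have h3 := wt_bk_left hS H
    have h4 := wt_bk_right hS H
    simp only [g]
    rw [sgn_bk hS hi hT'.1 H, ← smul_neg, alternant_sub_swap hi (α := T.wt) (by omega) (by omega)
      (fun t ht ht' => wt_bk_of_ne hS H ht ht'), neg_neg]
  rw [hone, ← Finset.sum_add_distrib]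
  have hg : ∑ T ∈ K.filter (fun T => ¬ P T), g T = 0 := by
    rw [Finset.sum_neg_distrib] at htwo
    exact self_eq_neg.1 htwo
  rw [← hg]
  refine Finset.sum_congr rfl fun T _ => ?_
  simp only [g, smul_sub]
  ring

open scoped Classical in
theorem _root_.grothendieck_mul_alternant_zero_eq_sum_isRLW
    (hS : (S : Set (ℕ × ℕ)).OrdConnected) (m : ℕ) :
    grothendieck S m * alternant m 0 =
      ∑ T ∈ (boundedSVT S m).filter (fun T => IsRLW T.word), T.sgn • alternant m T.wt := by
  rw [grothendieck_mul_alternant_zero hS, ← Finset.sum_filter_add_sum_filter_not _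
    (fun T => IsRLW T.word), add_eq_left]
  have hsplit : (boundedSVT S m).filter (fun T => ¬ IsRLW T.word) =
      (S ×ˢ Finset.range m).biUnion fun p => (boundedSVT S m).filter fun T => T.FirstBad p.1 p.2 := by
    ext T
    simp only [Finset.mem_filter, Finset.mem_biUnion, Finset.mem_product, Finset.mem_range,
      mem_boundedSVT, Prod.exists]
    constructor
    · rintro ⟨hT, hw⟩
      obtain ⟨⟨r, j⟩, i, h⟩ := exists_firstBad hw
      have := hT _ _ h.mem
      exact ⟨r, j, i, ⟨T.mem_cells h.mem, by omega⟩, hT, h⟩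
    · rintro ⟨r, j, i, -, hT, h⟩
      exact ⟨hT, h.not_isRLW⟩
  rw [hsplit, Finset.sum_biUnion]
  · exact Finset.sum_eq_zero fun p _ => sum_firstBad_eq_zero hS m p.1 p.2
  · intro p _ q _ hpq
    refine Finset.disjoint_left.2 fun T hp hq => hpq ?_
    have := (Finset.mem_filter.1 hp).2.unique (Finset.mem_filter.1 hq).2
    exact Prod.ext this.1 this.2

end SVT

theorem YoungDiagram.ordConnected_cells (nu : YoungDiagram) :
    (nu.cells : Set (ℕ × ℕ)).OrdConnected := nu.isLowerSet.ordConnected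

namespace SVT

variable {nu : YoungDiagram}

theorem row_le_of_mem (T : SVT nu.cells) {r j x : ℕ} (hx : x ∈ T.entry (r, j)) : r ≤ x := by
  induction r generalizing x with
  | zero => exact Nat.zero_le x
  | succ r ih =>
    have hc : (r, j) ∈ nu.cells := nu.isLowerSet (a := (r + 1, j)) ⟨by simp, le_rfl⟩ (T.mem_cells hx)
    obtain ⟨z, hz⟩ := T.nonempty_of_mem _ hc
    have h1 := ih hz
    have h2 := T.col_lt nu.ordConnected_cells (Nat.lt_succ_self r) hz hx
    omega

theorem eq_row_of_isRLW {T : SVT nu.cells} (hT : IsRLW T.word) {r j x : ℕ}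
    (hx : x ∈ T.entry (r, j)) : x = r := by
  induction r using Nat.strong_induction_on generalizing j x with
  | _ r ih =>
    by_contra hne
    have hrx := T.row_le_of_mem hx
    have hcell : j < nu.rowLen r := YoungDiagram.mem_iff_lt_rowLen.1 (T.mem_cells hx)
    obtain ⟨J, hJ⟩ : ∃ J, nu.rowLen r = J + 1 := ⟨nu.rowLen r - 1, by omega⟩
    obtain ⟨y, hy, hxy⟩ : ∃ y ∈ T.entry (r, J), x ≤ y := by
      rcases (show j ≤ J by omega).eq_or_lt with rfl | hlt
      · exact ⟨x, hx, le_rfl⟩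
      · have : (r, J) ∈ nu.cells := YoungDiagram.mem_iff_lt_rowLen.2 (by omega)
        obtain ⟨y, hy⟩ := T.nonempty_of_mem _ this
        exact ⟨y, hy, T.row_le nu.ordConnected_cells hlt hx hy⟩
    obtain ⟨i, rfl⟩ : ∃ i, y = i + 1 := ⟨y - 1, by omega⟩
    have h1 := T.isRLW_word_iff.1 hT ((r, J), i + 1) i
    have h2 : 0 < T.suffixCount ((r, J), i + 1) (i + 1) :=
      Finset.card_pos.2 ⟨(r, J), by simp [hy, T.mem_cells hy]⟩
    obtain ⟨⟨a, b⟩, hc⟩ := Finset.card_pos.1 (h2.trans_le h1)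
    simp only [Finset.mem_filter, readKey_le_iff] at hc
    obtain ⟨hab, hi, hk⟩ := hc
    have hb : b < nu.rowLen a := YoungDiagram.mem_iff_lt_rowLen.1 hab
    rcases lt_or_ge a r with har | har
    · have := ih a har hi
      omega
    · have := nu.rowLen_anti r a har
      omega

/-- The tableau of straight shape whose `r`-th row is filled with the letter `r`. -/
def superstandard (nu : YoungDiagram) : SVT nu.cells where
  entry c := if c ∈ nu.cells then {c.1} else ∅
  nonempty_of_mem c hc := by simp [hc]
  eq_empty_of_not_mem c hc := by simp [hc]
  row_weak r j h1 h2 a ha b hb := by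
    simp only [h1, h2, if_true, Finset.mem_singleton] at ha hb
    omega
  col_strict r j h1 h2 a ha b hb := by
    simp only [h1, h2, if_true, Finset.mem_singleton] at ha hb
    omega

theorem mem_superstandard {c : ℕ × ℕ} {x : ℕ} :
    x ∈ (superstandard nu).entry c ↔ c ∈ nu.cells ∧ x = c.1 := by
  change x ∈ (if c ∈ nu.cells then ({c.1} : Finset ℕ) else ∅) ↔ _
  by_cases hc : c ∈ nu.cells <;> simp [hc]

theorem eq_superstandard {T : SVT nu.cells} (hT : IsRLW T.word) : T = superstandard nu := by
  refine ext_entry fun c x => ?_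
  rw [mem_superstandard]
  constructor
  · exact fun hx => ⟨T.mem_cells hx, eq_row_of_isRLW hT hx⟩
  · rintro ⟨hc, rfl⟩
    obtain ⟨y, hy⟩ := T.nonempty_of_mem c hc
    have : y = c.1 := eq_row_of_isRLW hT hy
    exact this ▸ hy

theorem isRLW_superstandard (nu : YoungDiagram) : IsRLW (superstandard nu).word := by
  rw [isRLW_word_iff]
  rintro ⟨⟨r, j⟩, x⟩ i
  refine Finset.card_le_card_of_injOn (fun c => (c.1 - 1, c.2)) ?_ ?_
  · rintro ⟨a, b⟩ hc
    simp only [Finset.coe_filter, Set.mem_ofPred_eq, mem_superstandard, readKey_le_iff] at hc ⊢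
    obtain ⟨h1, ⟨-, rfl⟩, h2⟩ := hc
    have h3 : (i + 1 - 1, b) ∈ nu.cells :=
      nu.isLowerSet (a := (i + 1, b)) ⟨by simp, le_rfl⟩ h1
    refine ⟨h3, ⟨h3, by simp⟩, ?_⟩
    omega
  · rintro ⟨a, b⟩ hc ⟨a', b'⟩ hc' heq
    simp only [Finset.coe_filter, Set.mem_ofPred_eq, mem_superstandard, Prod.mk.injEq] at hc hc' heq
    obtain ⟨-, ⟨-, rfl⟩, -⟩ := hc
    obtain ⟨-, ⟨-, rfl⟩, -⟩ := hc'
    simp [heq.2]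

theorem wt_superstandard (nu : YoungDiagram) : (superstandard nu).wt = nu.rowLen := by
  funext t
  rw [YoungDiagram.rowLen_eq_card]
  unfold wt YoungDiagram.row
  congr 1
  refine Finset.filter_congr fun c hc => ?_
  rw [mem_superstandard]
  simp [hc, eq_comm]

theorem size_superstandard (nu : YoungDiagram) : (superstandard nu).size = nu.card := by
  unfold size
  rw [YoungDiagram.card, Finset.card_eq_sum_ones]
  refine Finset.sum_congr rfl fun c hc => ?_
  simp [superstandard, (YoungDiagram.mem_cells _).1 hc]

theorem sgn_superstandard (nu : YoungDiagram) : (superstandard nu).sgn = 1 := by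
  rw [sgn, size_superstandard]
  simp

theorem bounded_superstandard {m : ℕ} (h : nu.colLen 0 ≤ m) : (superstandard nu).Bounded m := by
  intro c x hx
  obtain ⟨hc, rfl⟩ := mem_superstandard.1 hx
  have : c.1 < nu.colLen c.2 := YoungDiagram.mem_iff_lt_colLen.1 hc
  have := nu.colLen_anti 0 c.2 (Nat.zero_le _)
  omega

end SVT

section straightShape

open SVT

theorem grothendieck_cells_mul_alternant_zero {nu : YoungDiagram} {m : ℕ} (h : nu.colLen 0 ≤ m) :
    grothendieck nu.cells m * alternant m 0 = alternant m nu.rowLen := by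
  classical
  rw [grothendieck_mul_alternant_zero_eq_sum_isRLW nu.ordConnected_cells, Finset.sum_eq_single
    (superstandard nu), sgn_superstandard, wt_superstandard, one_smul]
  · exact fun T hT hne => absurd (eq_superstandard (Finset.mem_filter.1 hT).2) hne
  · refine fun hT => absurd ?_ hT
    rw [Finset.mem_filter, mem_boundedSVT]
    exact ⟨bounded_superstandard h, isRLW_superstandard nu⟩

theorem grothendieck_cells_eq_zero {nu : YoungDiagram} {m : ℕ} (h : m < nu.colLen 0) :
    grothendieck nu.cells m = 0 := by
  rw [grothendieck_eq_sum]
  refine Finset.sum_eq_zero fun T hT => ?_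
  rw [mem_boundedSVT] at hT
  have hc : (m, 0) ∈ nu.cells := YoungDiagram.mem_iff_lt_colLen.2 h
  obtain ⟨x, hx⟩ := T.nonempty_of_mem _ hc
  have h1 := T.row_le_of_mem hx
  have h2 := hT _ _ hx
  omega

end straightShape

section starCells

open SVT

variable {lam mu : YoungDiagram}

theorem mem_starCells {r j : ℕ} : (r, j) ∈ starCells lam mu ↔
    (mu.rowLen 0 ≤ j ∧ (r, j - mu.rowLen 0) ∈ lam.cells) ∨
      (lam.colLen 0 ≤ r ∧ (r - lam.colLen 0, j) ∈ mu.cells) := by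
  unfold starCells
  simp only [Finset.mem_union, Finset.mem_image, Prod.exists, Prod.mk.injEq]
  refine or_congr ⟨?_, fun h => ⟨_, _, h.2, rfl, by omega⟩⟩
    ⟨?_, fun h => ⟨_, _, h.2, by omega, rfl⟩⟩
  · rintro ⟨a, b, h, rfl, rfl⟩
    simpa using h
  · rintro ⟨a, b, h, rfl, rfl⟩
    simpa using h

theorem YoungDiagram.row_lt_colLen_zero {nu : YoungDiagram} {r j : ℕ} (h : (r, j) ∈ nu.cells) :
    r < nu.colLen 0 :=
  (YoungDiagram.mem_iff_lt_colLen.1 h).trans_le (nu.colLen_anti 0 j (Nat.zero_le _))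

theorem YoungDiagram.col_lt_rowLen_zero {nu : YoungDiagram} {r j : ℕ} (h : (r, j) ∈ nu.cells) :
    j < nu.rowLen 0 :=
  (YoungDiagram.mem_iff_lt_rowLen.1 h).trans_le (nu.rowLen_anti 0 r (Nat.zero_le _))

theorem ordConnected_starCells (lam mu : YoungDiagram) :
    (starCells lam mu : Set (ℕ × ℕ)).OrdConnected := by
  refine ⟨?_⟩
  rintro ⟨a, b⟩ h ⟨a', b'⟩ h' ⟨r, j⟩ ⟨⟨h1, h2⟩, ⟨h3, h4⟩⟩
  simp only at h1 h2 h3 h4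
  rw [Finset.mem_coe, mem_starCells] at h h' ⊢
  rcases h with h | h <;> rcases h' with h' | h'
  · exact Or.inl ⟨h.1.trans h2, lam.isLowerSet (Prod.mk_le_mk.2 ⟨h3, by omega⟩) h'.2⟩
  · have := YoungDiagram.col_lt_rowLen_zero h'.2
    omega
  · have := YoungDiagram.row_lt_colLen_zero h'.2
    omega
  · exact Or.inr ⟨h.1.trans h1, mu.isLowerSet (Prod.mk_le_mk.2 ⟨by omega, h4⟩) h'.2⟩

theorem add_rowLen_mem_starCells {r j : ℕ} :
    (r, j + mu.rowLen 0) ∈ starCells lam mu ↔ (r, j) ∈ lam.cells := by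
  rw [mem_starCells]
  constructor
  · rintro (h | h)
    · simpa using h
    · have := YoungDiagram.col_lt_rowLen_zero h.2
      omega
  · intro h
    simpa using Or.inl h

theorem add_colLen_mem_starCells {r j : ℕ} :
    (r + lam.colLen 0, j) ∈ starCells lam mu ↔ (r, j) ∈ mu.cells := by
  rw [mem_starCells]
  constructor
  · rintro (h | h)
    · have := YoungDiagram.row_lt_colLen_zero h.2
      omega
    · simpa using h
  · intro h
    simpa using Or.inr h

@[to_additive]
theorem prod_starCells {M : Type*} [CommMonoid M] (f : ℕ × ℕ → M) :
    ∏ c ∈ starCells lam mu, f c = (∏ c ∈ lam.cells, f (c.1, c.2 + mu.rowLen 0)) *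
      ∏ c ∈ mu.cells, f (c.1 + lam.colLen 0, c.2) := by
  unfold starCells
  rw [Finset.prod_union, Finset.prod_image, Finset.prod_image]
  · rintro ⟨a, b⟩ - ⟨a', b'⟩ - h
    simpa using h
  · rintro ⟨a, b⟩ - ⟨a', b'⟩ - h
    simpa using h
  · refine Finset.disjoint_left.2 ?_
    rintro ⟨a, b⟩ h h'
    simp only [Finset.mem_image, Prod.mk.injEq, Prod.exists] at h h'
    obtain ⟨r, j, -, -, rfl⟩ := h
    obtain ⟨r', j', h', -, rfl⟩ := h'
    have := YoungDiagram.col_lt_rowLen_zero h'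
    omega

theorem card_starCells : (starCells lam mu).card = lam.card + mu.card := by
  rw [Finset.card_eq_sum_ones, sum_starCells, ← Finset.card_eq_sum_ones, ← Finset.card_eq_sum_ones]

namespace SVT

/-- The part of a tableau of shape `λ * μ` in the boxes of `λ`. -/
def starLeft (T : SVT (starCells lam mu)) : SVT lam.cells where
  entry c := T.entry (c.1, c.2 + mu.rowLen 0)
  nonempty_of_mem _ hc := T.nonempty_of_mem _ (add_rowLen_mem_starCells.2 hc)
  eq_empty_of_not_mem _ hc := T.eq_empty_of_not_mem _ (mt add_rowLen_mem_starCells.1 hc)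
  row_weak r j h1 h2 a ha b hb := by
    rw [← add_rowLen_mem_starCells (mu := mu)] at h1 h2
    simp only [Nat.add_right_comm j 1] at h2 hb
    exact T.row_weak _ _ h1 h2 a ha b hb
  col_strict _ _ h1 h2 a ha b hb :=
    T.col_strict _ _ (add_rowLen_mem_starCells.2 h1) (add_rowLen_mem_starCells.2 h2) a ha b hb

/-- The part of a tableau of shape `λ * μ` in the boxes of `μ`. -/
def starRight (T : SVT (starCells lam mu)) : SVT mu.cells where
  entry c := T.entry (c.1 + lam.colLen 0, c.2)
  nonempty_of_mem _ hc := T.nonempty_of_mem _ (add_colLen_mem_starCells.2 hc)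
  eq_empty_of_not_mem _ hc := T.eq_empty_of_not_mem _ (mt add_colLen_mem_starCells.1 hc)
  row_weak _ _ h1 h2 a ha b hb :=
    T.row_weak _ _ (add_colLen_mem_starCells.2 h1) (add_colLen_mem_starCells.2 h2) a ha b hb
  col_strict r j h1 h2 a ha b hb := by
    rw [← add_colLen_mem_starCells (lam := lam)] at h1 h2
    simp only [Nat.add_right_comm r 1] at h2 hb
    exact T.col_strict _ _ h1 h2 a ha b hb

/-- The tableau of shape `λ * μ` with given parts. -/
def starJoin (T : SVT lam.cells) (T' : SVT mu.cells) : SVT (starCells lam mu) where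
  entry c := if mu.rowLen 0 ≤ c.2 then T.entry (c.1, c.2 - mu.rowLen 0) else
    if lam.colLen 0 ≤ c.1 then T'.entry (c.1 - lam.colLen 0, c.2) else ∅
  nonempty_of_mem := by
    rintro ⟨r, j⟩ hc
    rcases mem_starCells.1 hc with ⟨h1, h2⟩ | ⟨h1, h2⟩
    · simpa [h1] using T.nonempty_of_mem _ h2
    · have h3 := (YoungDiagram.col_lt_rowLen_zero h2).not_ge
      simpa [h1, h3] using T'.nonempty_of_mem _ h2
  eq_empty_of_not_mem := by
    rintro ⟨r, j⟩ hc
    rw [mem_starCells, not_or, not_and, not_and] at hc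
    by_cases h1 : mu.rowLen 0 ≤ j
    · simpa [h1] using T.eq_empty_of_not_mem _ (hc.1 h1)
    · by_cases h2 : lam.colLen 0 ≤ r
      · simpa [h1, h2] using T'.eq_empty_of_not_mem _ (hc.2 h2)
      · simp [h1, h2]
  row_weak r j h1 h2 a ha b hb := by
    rcases mem_starCells.1 h1 with ⟨e1, e2⟩ | ⟨e1, e2⟩
    · have e3 : mu.rowLen 0 ≤ j + 1 := by omega
      have e4 : j + 1 - mu.rowLen 0 = j - mu.rowLen 0 + 1 := by omega
      simp only [e1, e3, if_true, e4] at ha hb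
      exact T.row_weak _ _ (T.mem_cells ha) (T.mem_cells hb) a ha b hb
    · have e3 := (YoungDiagram.col_lt_rowLen_zero e2).not_ge
      have e4 : ¬ mu.rowLen 0 ≤ j + 1 := by
        rcases mem_starCells.1 h2 with ⟨-, h⟩ | ⟨-, h⟩
        · have := YoungDiagram.row_lt_colLen_zero h
          omega
        · exact (YoungDiagram.col_lt_rowLen_zero h).not_ge
      simp only [e1, e3, e4, if_true, if_false] at ha hb
      exact T'.row_weak _ _ (T'.mem_cells ha) (T'.mem_cells hb) a ha b hb
  col_strict r j h1 h2 a ha b hb := by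
    rcases mem_starCells.1 h1 with ⟨e1, e2⟩ | ⟨e1, e2⟩
    · simp only [e1, if_true] at ha hb
      exact T.col_strict _ _ (T.mem_cells ha) (T.mem_cells hb) a ha b hb
    · have e3 := (YoungDiagram.col_lt_rowLen_zero e2).not_ge
      have e4 : lam.colLen 0 ≤ r + 1 := by omega
      have e5 : r + 1 - lam.colLen 0 = r - lam.colLen 0 + 1 := by omega
      simp only [e1, e3, e4, if_true, if_false, e5] at ha hb
      exact T'.col_strict _ _ (T'.mem_cells ha) (T'.mem_cells hb) a ha b hb

theorem starLeft_starJoin (T : SVT lam.cells) (T' : SVT mu.cells) :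
    (T.starJoin T').starLeft = T :=
  ext_entry fun c x => by simp [starLeft, starJoin]

theorem starRight_starJoin (T : SVT lam.cells) (T' : SVT mu.cells) :
    (T.starJoin T').starRight = T' := by
  refine ext_entry ?_
  rintro ⟨r, j⟩ x
  by_cases h : mu.rowLen 0 ≤ j
  · have h1 : (r, j) ∉ mu.cells := fun h' => (YoungDiagram.col_lt_rowLen_zero h').not_ge h
    rw [SVT.eq_empty_of_not_mem _ _ h1, SVT.eq_empty_of_not_mem _ _ h1]
  · simp [starRight, starJoin, h]

theorem starJoin_starLeft_starRight (T : SVT (starCells lam mu)) :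
    T.starLeft.starJoin T.starRight = T := by
  refine ext_entry ?_
  rintro ⟨r, j⟩ x
  by_cases hc : (r, j) ∈ starCells lam mu
  · rcases mem_starCells.1 hc with ⟨e1, e2⟩ | ⟨e1, e2⟩
    · simp [starJoin, starLeft, e1]
    · have e3 := (YoungDiagram.col_lt_rowLen_zero e2).not_ge
      simp [starJoin, starRight, e1, e3]
  · rw [SVT.eq_empty_of_not_mem _ _ hc, SVT.eq_empty_of_not_mem _ _ hc]

theorem size_starLeft_add (T : SVT (starCells lam mu)) :
    T.starLeft.size + T.starRight.size = T.size :=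
  (sum_starCells fun c => (T.entry c).card).symm

theorem monomial_starLeft_mul (T : SVT (starCells lam mu)) :
    T.starLeft.monomial * T.starRight.monomial = T.monomial :=
  (prod_starCells fun c => ∏ i ∈ T.entry c, (X i : MvPolynomial ℕ ℤ)).symm

theorem sgn_starLeft_mul (T : SVT (starCells lam mu)) :
    T.starLeft.sgn * T.starRight.sgn = T.sgn := by
  have h1 := T.starLeft.card_le_size
  have h2 := T.starRight.card_le_size
  have h3 := T.size_starLeft_add
  have h4 : (starCells lam mu).card = lam.cells.card + mu.cells.card := card_starCells
  unfold sgn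
  rw [← pow_add]
  congr 1
  omega

theorem bounded_star_iff {T : SVT (starCells lam mu)} {m : ℕ} :
    T.Bounded m ↔ T.starLeft.Bounded m ∧ T.starRight.Bounded m := by
  refine ⟨fun h => ⟨fun c => h _, fun c => h _⟩, ?_⟩
  rintro ⟨h1, h2⟩ ⟨r, j⟩ x hx
  rw [← T.starJoin_starLeft_starRight] at hx
  simp only [starJoin] at hx
  split_ifs at hx
  · exact h1 _ _ hx
  · exact h2 _ _ hx
  · simp at hx

end SVT

theorem grothendieck_starCells (m : ℕ) : grothendieck (starCells lam mu) m =
    grothendieck lam.cells m * grothendieck mu.cells m := by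
  simp only [grothendieck_eq_sum]
  rw [Finset.sum_mul_sum, ← Finset.sum_product']
  refine Finset.sum_bij' (fun T _ => (T.starLeft, T.starRight)) (fun p _ => p.1.starJoin p.2)
    ?_ ?_ ?_ ?_ ?_
  · intro T hT
    rw [mem_boundedSVT, bounded_star_iff] at hT
    simpa [mem_boundedSVT] using hT
  · rintro ⟨T, T'⟩ hT
    simp only [Finset.mem_product, mem_boundedSVT] at hT
    rw [mem_boundedSVT, bounded_star_iff]
    rwa [starLeft_starJoin, starRight_starJoin]
  · exact fun T _ => T.starJoin_starLeft_starRight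
  · exact fun p _ => Prod.ext (starLeft_starJoin _ _) (starRight_starJoin _ _)
  · intro T _
    rw [smul_mul_smul_comm, sgn_starLeft_mul, monomial_starLeft_mul]

end starCells

theorem YoungDiagram.ext_rowLen {nu nu' : YoungDiagram} (h : ∀ i, nu.rowLen i = nu'.rowLen i) :
    nu = nu' := by
  refine YoungDiagram.ext (Finset.ext ?_)
  rintro ⟨i, j⟩
  simp only [YoungDiagram.mem_cells, YoungDiagram.mem_iff_lt_rowLen, h]

theorem YoungDiagram.colLen_zero_le_iff {nu : YoungDiagram} {m : ℕ} :
    nu.colLen 0 ≤ m ↔ nu.rowLen m = 0 := by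
  rw [← not_lt, ← YoungDiagram.mem_iff_lt_colLen, YoungDiagram.mem_iff_lt_rowLen,
    Nat.pos_iff_ne_zero, not_not]

theorem YoungDiagram.exists_rowLen_eq {f : ℕ → ℕ} (hf : Antitone f) {m : ℕ} (hm : f m = 0) :
    ∃ nu : YoungDiagram, ∀ i, nu.rowLen i = f i := by
  let nu : YoungDiagram := ⟨(Finset.range m).biUnion fun i => (Finset.range (f i)).image (i, ·), by
    rintro ⟨a, b⟩ ⟨c, d⟩ ⟨h1, h2⟩ h
    simp only [Finset.coe_biUnion, Finset.coe_range, Set.mem_Iio, Finset.coe_image, Set.mem_iUnion,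
      Set.mem_image, Prod.mk.injEq, exists_prop] at h1 h2 h ⊢
    obtain ⟨_, ha, _, hb, rfl, rfl⟩ := h
    have := hf h1
    exact ⟨c, by omega, d, by omega, rfl, rfl⟩⟩
  have hmem : ∀ i j, (i, j) ∈ nu ↔ j < f i := by
    intro i j
    rw [← YoungDiagram.mem_cells]
    simp only [nu, Finset.mem_biUnion, Finset.mem_range, Finset.mem_image, Prod.mk.injEq]
    constructor
    · rintro ⟨_, -, _, h, rfl, rfl⟩
      exact h
    · intro h
      refine ⟨i, ?_, j, h, rfl, rfl⟩
      by_contra hi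
      have := hf (not_lt.1 hi)
      omega
  refine ⟨nu, fun i => ?_⟩
  refine le_antisymm (le_of_forall_lt fun j hj => ?_) (le_of_forall_lt fun j hj => ?_)
  · exact (hmem i j).1 (YoungDiagram.mem_iff_lt_rowLen.2 hj)
  · exact YoungDiagram.mem_iff_lt_rowLen.1 ((hmem i j).2 hj)

namespace SVT

variable {S : Finset (ℕ × ℕ)} {T : SVT S} {nu : YoungDiagram} {m : ℕ}

theorem hasContent_word_iff : HasContent T.word nu ↔ ∀ i, nu.rowLen i = T.wt i := by
  simp only [HasContent, count_word, eq_comm]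

theorem wt_eq_zero (hT : T.Bounded m) {t : ℕ} (ht : m ≤ t) : T.wt t = 0 := by
  rw [wt, Finset.card_eq_zero, Finset.filter_eq_empty_iff]
  intro c _ hc
  have := hT c t hc
  omega

theorem exists_hasContent (hT : T.Bounded m) (hw : IsRLW T.word) :
    ∃ nu : YoungDiagram, HasContent T.word nu := by
  simp only [hasContent_word_iff]
  refine YoungDiagram.exists_rowLen_eq (antitone_nat_of_succ_le fun i => ?_)
    (wt_eq_zero hT le_rfl)
  simpa only [count_word] using hw T.word List.suffix_rfl i

theorem hasContent_unique {nu' : YoungDiagram} (h : HasContent T.word nu)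
    (h' : HasContent T.word nu') : nu = nu' :=
  YoungDiagram.ext_rowLen fun i => (h i).symm.trans (h' i)

theorem bounded_iff_of_hasContent (h : HasContent T.word nu) :
    T.Bounded m ↔ nu.colLen 0 ≤ m := by
  rw [hasContent_word_iff] at h
  rw [YoungDiagram.colLen_zero_le_iff]
  constructor
  · intro hT
    rw [h, wt_eq_zero hT le_rfl]
  · intro hm c x hx
    by_contra hxm
    have h1 := nu.rowLen_anti m x (not_lt.1 hxm)
    have h2 : 0 < T.wt x := Finset.card_pos.2 ⟨c, by simp [hx, T.mem_cells hx]⟩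
    have := h x
    omega

theorem size_eq_card_of_hasContent (h : HasContent T.word nu) : T.size = nu.card := by
  rw [size_eq_sum_wt ((bounded_iff_of_hasContent h).2 le_rfl), ← size_superstandard,
    size_eq_sum_wt (bounded_superstandard le_rfl), wt_superstandard]
  exact Finset.sum_congr rfl fun t _ => (hasContent_word_iff.1 h t).symm

end SVT

/-- **The Littlewood–Richardson rule for stable Grothendieck polynomials**
(Theorem 5.4 / Corollary 5.5): for all partitions `λ, μ` and every `m ≥ 1`,
`G_λ(x_1,…,x_m) · G_μ(x_1,…,x_m) = Σ_ν c^ν_{λμ} G_ν(x_1,…,x_m)`,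
the (finitely supported) sum being over all partitions `ν`. -/
theorem grothendieck_littlewood_richardson (lam mu : YoungDiagram) (m : ℕ) (hm : 1 ≤ m) :
    grothendieck lam.cells m * grothendieck mu.cells m =
      ∑ᶠ nu : YoungDiagram, cLR lam mu nu • grothendieck nu.cells m := by
  classical
  set R := (boundedSVT (starCells lam mu) m).filter fun T => IsRLW T.word with hR
  have hmem : ∀ T, T ∈ R ↔ T.Bounded m ∧ IsRLW T.word := by simp [hR, mem_boundedSVT]
  have hex : ∀ T, ∃ nu : YoungDiagram, T ∈ R → HasContent T.word nu := fun T => by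
    by_cases hT : T ∈ R
    · obtain ⟨nu, h⟩ := SVT.exists_hasContent ((hmem T).1 hT).1 ((hmem T).1 hT).2
      exact ⟨nu, fun _ => h⟩
    · exact ⟨⊥, fun h => absurd h hT⟩
  choose shape hshape using hex
  have hiff : ∀ nu : YoungDiagram, nu.colLen 0 ≤ m → ∀ T,
      T ∈ R.filter (fun T => shape T = nu) ↔ IsRLW T.word ∧ HasContent T.word nu := by
    intro nu hnu T
    rw [Finset.mem_filter]
    constructor
    · rintro ⟨hT, rfl⟩
      exact ⟨((hmem T).1 hT).2, hshape T hT⟩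
    · rintro ⟨hw, hc⟩
      have hT : T ∈ R := (hmem T).2 ⟨(SVT.bounded_iff_of_hasContent hc).2 hnu, hw⟩
      exact ⟨hT, SVT.hasContent_unique (hshape T hT) hc⟩
  have hcol : ∀ T ∈ R, (shape T).colLen 0 ≤ m := fun T hT =>
    (SVT.bounded_iff_of_hasContent (hshape T hT)).1 ((hmem T).1 hT).1
  have hsgn : ∀ T ∈ R, T.sgn = (-1) ^ ((shape T).card - lam.card - mu.card) := by
    intro T hT
    rw [SVT.sgn, SVT.size_eq_card_of_hasContent (hshape T hT), card_starCells, Nat.sub_sub]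
  have hexpand : grothendieck lam.cells m * grothendieck mu.cells m =
      ∑ T ∈ R, T.sgn • grothendieck (shape T).cells m := by
    refine mul_right_cancel₀ (alternant_zero_ne_zero m) ?_
    rw [← grothendieck_starCells,
      grothendieck_mul_alternant_zero_eq_sum_isRLW (ordConnected_starCells lam mu), Finset.sum_mul]
    refine Finset.sum_congr rfl fun T hT => ?_
    rw [smul_mul_assoc, grothendieck_cells_mul_alternant_zero (hcol T hT)]
    congr 1
    exact alternant_congr fun t _ => (SVT.hasContent_word_iff.1 (hshape T hT) t).symm
  have hsupp : Function.support (fun nu => cLR lam mu nu • grothendieck nu.cells m) ⊆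
      (R.image shape : Finset YoungDiagram) := by
    intro nu hnu
    have hcolnu : nu.colLen 0 ≤ m := by
      by_contra hlt
      exact hnu (by simp only [grothendieck_cells_eq_zero (not_le.1 hlt), smul_zero])
    have hne : Nat.card {T : SVT (starCells lam mu) // IsRLW T.word ∧ HasContent T.word nu} ≠ 0 :=
      fun h0 => hnu (by simp only [cLR, h0, Nat.cast_zero, mul_zero, zero_smul])
    obtain ⟨⟨T, hT⟩⟩ := (Nat.card_ne_zero.1 hne).1
    have := Finset.mem_filter.1 ((hiff nu hcolnu T).2 hT)
    exact Finset.mem_coe.2 (Finset.mem_image.2 ⟨T, this⟩)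
  rw [hexpand, finsum_eq_sum_of_support_subset _ hsupp,
    ← Finset.sum_fiberwise_of_maps_to fun T hT => Finset.mem_image_of_mem shape hT]
  refine Finset.sum_congr rfl fun nu hnu => ?_
  obtain ⟨T₀, hT₀, rfl⟩ := Finset.mem_image.1 hnu
  rw [cLR, Nat.subtype_card _ (hiff _ (hcol T₀ hT₀)), mul_comm, ← nsmul_eq_mul, ← Finset.sum_const,
    Finset.sum_smul]
  refine Finset.sum_congr rfl fun T hT => ?_
  obtain ⟨hT, hT'⟩ := Finset.mem_filter.1 hT
  rw [hsgn T hT, hT']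
end

section
/- (Reverse lattice words and the local plactic monoid) Let M be the quotient of the free monoid on generators u_1, u_2, u_3, … by the congruence generated by the relations u_i u_j = u_j u_i whenever |i−j| ≥ 2, u_i u_{i+1} u_i = u_{i+1} u_i u_i, and u_{i+1} u_i u_{i+1} = u_{i+1} u_{i+1} u_i. For a partition ν = (ν_1,…,ν_p) set u^ν = u_p^{ν_p} ··· u_2^{ν_2} u_1^{ν_1} ∈ M. Then a sequence (i_1, i_2, …, i_ℓ) of positive integers is a reverse lattice word with content ν if and only if u_{i_1} u_{i_2} ··· u_{i_ℓ} = u^ν in M. -/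
open MvPolynomial

/-- The defining relations of the local plactic monoid on generators
`u_0, u_1, u_2, …`:  `u_i u_j = u_j u_i` for `|i - j| ≥ 2`,
`u_i u_{i+1} u_i = u_{i+1} u_i u_i` and `u_{i+1} u_i u_{i+1} = u_{i+1} u_{i+1} u_i`. -/
def lpRel : FreeMonoid ℕ → FreeMonoid ℕ → Prop := fun a b =>
  (∃ i j, (i + 2 ≤ j ∨ j + 2 ≤ i) ∧
    a = FreeMonoid.of i * FreeMonoid.of j ∧ b = FreeMonoid.of j * FreeMonoid.of i) ∨
  (∃ i, a = FreeMonoid.of i * FreeMonoid.of (i + 1) * FreeMonoid.of i ∧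
    b = FreeMonoid.of (i + 1) * FreeMonoid.of i * FreeMonoid.of i) ∨
  (∃ i, a = FreeMonoid.of (i + 1) * FreeMonoid.of i * FreeMonoid.of (i + 1) ∧
    b = FreeMonoid.of (i + 1) * FreeMonoid.of (i + 1) * FreeMonoid.of i)

/-- The local plactic monoid: the quotient of the free monoid on
`u_0, u_1, u_2, …` by the congruence generated by the local plactic
relations. -/
abbrev LocalPlactic := (conGen lpRel).Quotient

/-- The generator `u_i` of the local plactic monoid. -/
def lpU (i : ℕ) : LocalPlactic := (conGen lpRel).mk' (FreeMonoid.of i)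

/-- `u^ν = u_{p-1}^{ν_p} ⋯ u_1^{ν_2} u_0^{ν_1}` for a partition `ν` with `p`
rows (`0`-based rows). -/
def lpOfPartition (nu : YoungDiagram) : LocalPlactic :=
  (((List.range (nu.colLen 0)).reverse).map fun i => lpU i ^ nu.rowLen i).prod

/-! ### Equality of words in the local plactic monoid -/

lemma lpU_mul_comm {i j : ℕ} (h : i + 2 ≤ j ∨ j + 2 ≤ i) : lpU i * lpU j = lpU j * lpU i :=
  (Con.eq _).2 (ConGen.Rel.of _ _ (Or.inl ⟨i, j, h, rfl, rfl⟩))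

lemma commute_lpU_mul_right (i : ℕ) : Commute (lpU i) (lpU (i + 1) * lpU i) := by
  have h : lpU i * lpU (i + 1) * lpU i = lpU (i + 1) * lpU i * lpU i :=
    (Con.eq _).2 (ConGen.Rel.of _ _ (Or.inr (Or.inl ⟨i, rfl, rfl⟩)))
  rw [commute_iff_eq, ← mul_assoc, h]

lemma commute_lpU_mul_left (i : ℕ) : Commute (lpU (i + 1)) (lpU (i + 1) * lpU i) := by
  have h : lpU (i + 1) * lpU i * lpU (i + 1) = lpU (i + 1) * lpU (i + 1) * lpU i :=
    (Con.eq _).2 (ConGen.Rel.of _ _ (Or.inr (Or.inr ⟨i, rfl, rfl⟩)))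
  rw [commute_iff_eq, ← mul_assoc, h]

lemma pow_mul_pow_eq_mul_pow_of_commute {M : Type*} [Monoid M] {x y : M}
    (h : Commute y (y * x)) (a : ℕ) : y ^ a * x ^ a = (y * x) ^ a := by
  induction a with
  | zero => simp
  | succ a ih =>
    calc y ^ (a + 1) * x ^ (a + 1) = y ^ a * (y * x) * x ^ a := by
          rw [pow_succ, pow_succ' x]; simp only [mul_assoc]
      _ = (y * x) ^ (a + 1) := by
          rw [(h.pow_left a).eq, mul_assoc, ih, pow_succ']

lemma lpU_mul_pow_mul_pow (i : ℕ) {a b : ℕ} (h : a ≤ b) :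
    lpU i * (lpU (i + 1) ^ a * lpU i ^ b) = lpU (i + 1) ^ a * lpU i ^ (b + 1) := by
  obtain ⟨c, rfl⟩ := Nat.exists_eq_add_of_le h
  have hc : Commute (lpU i) (lpU (i + 1) ^ a * lpU i ^ a) := by
    rw [pow_mul_pow_eq_mul_pow_of_commute (commute_lpU_mul_left i)]
    exact (commute_lpU_mul_right i).pow_right a
  rw [pow_add, ← mul_assoc (lpU (i + 1) ^ a), ← mul_assoc, hc.eq, add_assoc, pow_add, pow_succ',
    mul_assoc, mul_assoc]

/-- The product `u_{n-1}^{f (n-1)} ⋯ u_1^{f 1} u_0^{f 0}`. -/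
def lpOfContent (f : ℕ → ℕ) (n : ℕ) : LocalPlactic :=
  ((List.range n).reverse.map fun i => lpU i ^ f i).prod

lemma lpOfContent_zero (f : ℕ → ℕ) : lpOfContent f 0 = 1 := by simp [lpOfContent]

lemma lpOfContent_succ (f : ℕ → ℕ) (n : ℕ) :
    lpOfContent f (n + 1) = lpU n ^ f n * lpOfContent f n := by
  simp [lpOfContent, List.range_succ]

lemma lpOfContent_congr {f g : ℕ → ℕ} {n : ℕ} (h : ∀ i < n, f i = g i) :
    lpOfContent f n = lpOfContent g n := by
  induction n with
  | zero => simp [lpOfContent_zero]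
  | succ n ih =>
    rw [lpOfContent_succ, lpOfContent_succ, h n n.lt_succ_self, ih fun i hi => h i (by omega)]

lemma lpU_mul_lpOfContent {f g : ℕ → ℕ} {i n : ℕ} (hi : i < n) (hf : f (i + 1) ≤ f i)
    (hgi : g i = f i + 1) (hg : ∀ j, j ≠ i → g j = f j) :
    lpU i * lpOfContent f n = lpOfContent g n := by
  have hlow : lpOfContent f i = lpOfContent g i :=
    lpOfContent_congr fun j hj => (hg j hj.ne).symm
  induction n with
  | zero => omega
  | succ n ih =>
    rcases (Nat.lt_succ_iff.1 hi).eq_or_lt with rfl | hin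
    · rw [lpOfContent_succ, lpOfContent_succ, hgi, hlow, pow_succ', mul_assoc]
    rcases (Nat.succ_le_of_lt hin).eq_or_lt with rfl | hin'
    · rw [lpOfContent_succ, lpOfContent_succ, lpOfContent_succ, lpOfContent_succ, hgi, hlow,
        hg (i + 1) (by omega), ← mul_assoc (lpU (i + 1) ^ _), ← mul_assoc (lpU i),
        lpU_mul_pow_mul_pow i hf, mul_assoc]
    · have hc : Commute (lpU i) (lpU n ^ f n) :=
        Commute.pow_right (lpU_mul_comm (Or.inl hin')) _
      rw [lpOfContent_succ, lpOfContent_succ, hg n (by omega), ← ih hin, ← mul_assoc, hc.eq,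
        mul_assoc]

/-! ### Reverse lattice words -/

lemma isRLW_nil : IsRLW [] := by
  intro s hs i
  simp [List.suffix_nil.1 hs]

lemma isRLW_cons {a : ℕ} {w : List ℕ} :
    IsRLW (a :: w) ↔ (∀ i, (a :: w).count (i + 1) ≤ (a :: w).count i) ∧ IsRLW w := by
  simp only [IsRLW, List.suffix_cons_iff, or_imp, forall_and, forall_eq]

lemma IsRLW.count_succ_le {w : List ℕ} (h : IsRLW w) (i : ℕ) : w.count (i + 1) ≤ w.count i :=
  h w (List.suffix_refl w) i

lemma prod_map_lpU_eq_lpOfContent {w : List ℕ} (hw : IsRLW w) {n : ℕ} (hn : ∀ i ∈ w, i < n) :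
    (w.map lpU).prod = lpOfContent (fun i => w.count i) n := by
  induction w with
  | nil =>
    clear hn
    induction n with
    | zero => simp [lpOfContent_zero]
    | succ n ih => rw [lpOfContent_succ, ← ih]; simp
  | cons a w ih =>
    have hw' := (isRLW_cons.1 hw).2
    rw [List.map_cons, List.prod_cons, ih hw' fun i hi => hn i (List.mem_cons_of_mem _ hi)]
    refine lpU_mul_lpOfContent (hn a List.mem_cons_self) (hw'.count_succ_le a) ?_ ?_
    · simp
    · intro j hj
      simp [hj.symm]

lemma isRLW_append_congr {x y : List ℕ} (hc : ∀ i, x.count i = y.count i)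
    (h : IsRLW x ↔ IsRLW y) (a : List ℕ) : IsRLW (a ++ x) ↔ IsRLW (a ++ y) := by
  induction a with
  | nil => exact h
  | cons b a ih =>
    simp only [List.cons_append, isRLW_cons, ih, List.count_cons, List.count_append, hc]

lemma lpRel_count_eq {x y : List ℕ} (h : lpRel (FreeMonoid.ofList x) (FreeMonoid.ofList y))
    (i : ℕ) : x.count i = y.count i := by
  rcases h with ⟨j, k, -, hx, hy⟩ | ⟨j, hx, hy⟩ | ⟨j, hx, hy⟩ <;>
  · replace hx := congrArg FreeMonoid.toList hx
    replace hy := congrArg FreeMonoid.toList hy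
    simp only [FreeMonoid.toList_ofList, FreeMonoid.toList_mul, FreeMonoid.toList_of] at hx hy
    subst hx hy
    simp only [List.count_append]
    omega

lemma lpRel_isRLW_append_iff {x y : List ℕ}
    (h : lpRel (FreeMonoid.ofList x) (FreeMonoid.ofList y)) (b : List ℕ) :
    IsRLW (x ++ b) ↔ IsRLW (y ++ b) := by
  rcases h with ⟨j, k, hjk, hx, hy⟩ | ⟨j, hx, hy⟩ | ⟨j, hx, hy⟩ <;>
  · replace hx := congrArg FreeMonoid.toList hx
    replace hy := congrArg FreeMonoid.toList hy
    simp only [FreeMonoid.toList_ofList, FreeMonoid.toList_mul, FreeMonoid.toList_of] at hx hy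
    subst hx hy
    simp only [List.cons_append, List.nil_append, isRLW_cons, ← and_assoc]
    refine and_congr_left fun hb => ?_
    have hb' := hb.count_succ_le
    simp only [List.count_cons, beq_iff_eq, ← forall_and]
    refine forall_congr' fun i => ?_
    have := hb' i
    split_ifs <;> omega

lemma conGen_lpRel_isRLW_iff {x y : FreeMonoid ℕ} (h : conGen lpRel x y) :
    (∀ i, x.toList.count i = y.toList.count i) ∧
      ∀ a b, IsRLW (a ++ x.toList ++ b) ↔ IsRLW (a ++ y.toList ++ b) := by
  replace h : ConGen.Rel lpRel x y := h
  induction h with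
  | of x y h =>
    have hc := lpRel_count_eq (x := x.toList) (y := y.toList) h
    refine ⟨hc, fun a b => ?_⟩
    rw [List.append_assoc, List.append_assoc]
    exact isRLW_append_congr (x := x.toList ++ b) (y := y.toList ++ b)
      (fun i => by simp only [List.count_append, hc])
      (lpRel_isRLW_append_iff (x := x.toList) (y := y.toList) h b) a
  | refl => exact ⟨fun _ => rfl, fun _ _ => Iff.rfl⟩
  | symm _ ih => exact ⟨fun i => (ih.1 i).symm, fun a b => (ih.2 a b).symm⟩
  | trans _ _ ih₁ ih₂ =>
    exact ⟨fun i => (ih₁.1 i).trans (ih₂.1 i), fun a b => (ih₁.2 a b).trans (ih₂.2 a b)⟩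
  | @mul w x y z _ _ ih₁ ih₂ =>
    refine ⟨fun i => ?_, fun a b => ?_⟩
    · simp only [FreeMonoid.toList_mul, List.count_append, ih₁.1, ih₂.1]
    · have h₁ := ih₁.2 a (y.toList ++ b)
      have h₂ := ih₂.2 (a ++ x.toList) b
      simp only [FreeMonoid.toList_mul, List.append_assoc] at h₁ h₂ ⊢
      exact h₁.trans h₂

lemma prod_map_lpU (w : List ℕ) :
    (w.map lpU).prod = (conGen lpRel).mk' (FreeMonoid.ofList w) := by
  induction w with
  | nil => rfl
  | cons a w ih => rw [List.map_cons, List.prod_cons, ih, FreeMonoid.ofList_cons, map_mul]; rfl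

lemma count_eq_and_isRLW_iff_of_prod_map_lpU_eq {w v : List ℕ}
    (h : (w.map lpU).prod = (v.map lpU).prod) :
    (∀ i, w.count i = v.count i) ∧ (IsRLW w ↔ IsRLW v) := by
  rw [prod_map_lpU, prod_map_lpU] at h
  obtain ⟨hc, hr⟩ := conGen_lpRel_isRLW_iff ((Con.eq _).1 h)
  exact ⟨hc, by simpa using hr [] []⟩

/-! ### The word of a partition -/

/-- The word `(n-1)^{f (n-1)} ⋯ 1^{f 1} 0^{f 0}`. -/
def wordOfContent (f : ℕ → ℕ) : ℕ → List ℕ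
  | 0 => []
  | n + 1 => List.replicate (f n) n ++ wordOfContent f n

lemma prod_map_lpU_wordOfContent (f : ℕ → ℕ) (n : ℕ) :
    ((wordOfContent f n).map lpU).prod = lpOfContent f n := by
  induction n with
  | zero => simp [wordOfContent, lpOfContent_zero]
  | succ n ih => simp [wordOfContent, lpOfContent_succ, ih]

lemma count_wordOfContent (f : ℕ → ℕ) (n i : ℕ) :
    (wordOfContent f n).count i = if i < n then f i else 0 := by
  induction n with
  | zero => simp [wordOfContent]
  | succ n ih =>
    rw [wordOfContent, List.count_append, ih, List.count_replicate]
    rcases lt_trichotomy i n with h | rfl | h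
    · simp [h, h.ne', h.trans n.lt_succ_self]
    · simp
    · simp [h.ne, h.not_gt, Nat.not_lt.2 (Nat.succ_le_of_lt h)]

lemma isRLW_wordOfContent {f : ℕ → ℕ} (hf : Antitone f) (n : ℕ) : IsRLW (wordOfContent f n) := by
  induction n with
  | zero => exact isRLW_nil
  | succ n ih =>
    suffices h : ∀ k ≤ f n, IsRLW (List.replicate k n ++ wordOfContent f n) from h _ le_rfl
    intro k hk
    induction k with
    | zero => exact ih
    | succ k ihk =>
      rw [List.replicate_succ, List.cons_append]
      refine isRLW_cons.2 ⟨fun i => ?_, ihk (by omega)⟩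
      rw [← List.cons_append, ← List.replicate_succ]
      have hi := hf i.le_succ
      simp only [List.count_append, List.count_replicate, count_wordOfContent, beq_iff_eq]
      rcases lt_trichotomy (i + 1) n with h | rfl | h <;> grind

/-- **Lemma 5.3**: a sequence of `0`-based letters is a reverse lattice word
with content `ν` if and only if the product of the corresponding generators of
the local plactic monoid equals `u^ν`. -/
theorem isRLW_hasContent_iff_localPlactic (w : List ℕ) (nu : YoungDiagram) :
    (IsRLW w ∧ HasContent w nu) ↔ (w.map lpU).prod = lpOfPartition nu := by
  have hrow : ∀ i, ¬ i < nu.colLen 0 → nu.rowLen i = 0 := fun i hi => by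
    rwa [← YoungDiagram.mem_iff_lt_colLen, YoungDiagram.mem_iff_lt_rowLen, Nat.pos_iff_ne_zero,
      not_not] at hi
  change _ ↔ _ = lpOfContent nu.rowLen (nu.colLen 0)
  constructor
  · rintro ⟨hw, hc⟩
    rw [prod_map_lpU_eq_lpOfContent hw (n := nu.colLen 0) fun i hi => ?_]
    · exact lpOfContent_congr fun i _ => hc i
    · by_contra h
      exact (List.count_pos_iff.2 hi).ne' ((hc i).trans (hrow i h))
  · intro h
    rw [← prod_map_lpU_wordOfContent] at h
    obtain ⟨hc, hr⟩ := count_eq_and_isRLW_iff_of_prod_map_lpU_eq h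
    refine ⟨hr.2 (isRLW_wordOfContent (fun i j hij => nu.rowLen_anti i j hij) _), fun i => ?_⟩
    rw [hc, count_wordOfContent]
    split_ifs with hi
    · rfl
    · exact (hrow i hi).symm
end
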